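/- Fix an integer M ≥ 1, γ > 0 and a real number α. There exists a nonzero constant C, depending only on M, γ and the chosen normalization of the measure (but not on X or on α), such that for every M×M Hermitian complex matrix X with pairwise distinct nonzero eigenvalues x_1, …, x_M: ∫ e^{-i·Tr(KX)} · det[ γ²·1_M + (K - γα·1_M)² ]^{-M} dK = C · e^{-iγα·Tr X} · det[ f_M^{(i-1)}(x_j) ]_{i,j=1}^{M} / ∏_{1≤i<j≤M}(x_i - x_j), where the integral is over the real vector space of M×M Hermitian complex matrices K with respect to an additive Haar (Lebesgue) measure. -/

import Mathlib

open MeasureTheory Matrix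

/-- Matrices inherit the (Borel) measurable structure of the underlying pi type. -/
noncomputable instance matrixMeasurableSpace {m n α : Type*} [MeasurableSpace α] :
    MeasurableSpace (Matrix m n α) :=
  inferInstanceAs (MeasurableSpace (m → n → α))

/-- For an integer `M ≥ 1` and real `γ > 0`, the function
`f_M(x) = (π/(γ^{2M-1} 2^{M-1} (M-1)!)) · e^{-γ|x|} ·
  ∑_{l=0}^{M-1} ((M-1+l)!/(l!(M-1-l)! 2^l)) |γx|^{M-1-l}`. -/
noncomputable def fM (γ : ℝ) (M : ℕ) (x : ℝ) : ℝ :=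
  Real.pi / (γ ^ (2 * M - 1) * 2 ^ (M - 1) * (Nat.factorial (M - 1))) *
    Real.exp (-γ * |x|) *
    ∑ l ∈ Finset.range M,
      ((Nat.factorial (M - 1 + l) : ℝ) /
        ((Nat.factorial l : ℝ) * (Nat.factorial (M - 1 - l) : ℝ) * 2 ^ l)) *
      |γ * x| ^ (M - 1 - l)

theorem abs_det_eq_one_of_image_eq {E : Type*} [NormedAddCommGroup E] [NormedSpace ℝ E]
    [MeasurableSpace E] [BorelSpace E] [FiniteDimensional ℝ E] (μ : Measure E)
    [μ.IsAddHaarMeasure] (f : E →ₗ[ℝ] E) {s : Set E} (hs : f '' s = s) (h0 : μ s ≠ 0)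
    (htop : μ s ≠ ⊤) : |LinearMap.det f| = 1 := by
  have h := Measure.addHaar_image_linearMap μ f s
  rw [hs] at h
  have h1 : ENNReal.ofReal |LinearMap.det f| = 1 := by
    have : 1 * μ s = ENNReal.ofReal |LinearMap.det f| * μ s := by rw [one_mul]; exact h
    exact ((ENNReal.mul_left_inj h0 htop).1 this).symm
  simpa using h1

theorem sum_sq_norm_eq_re_star_dotProduct {n : ℕ} (z : Fin n → ℂ) :
    ((∑ i, ‖z i‖ ^ 2 : ℝ) : ℂ) = star z ⬝ᵥ z := by
  simp [dotProduct, Complex.conj_mul']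

theorem star_mulVec_dotProduct_mulVec_unitary {n : ℕ} {U : Matrix (Fin n) (Fin n) ℂ}
    (hU : star U * U = 1) (z : Fin n → ℂ) : star (U *ᵥ z) ⬝ᵥ (U *ᵥ z) = star z ⬝ᵥ z := by
  rw [star_mulVec, dotProduct_mulVec, vecMul_vecMul, ← star_eq_conjTranspose, hU, vecMul_one]

theorem sum_sq_norm_unitary_mulVec {n : ℕ} {U : Matrix (Fin n) (Fin n) ℂ}
    (hU : star U * U = 1) (z : Fin n → ℂ) :
    ∑ i, ‖(U *ᵥ z) i‖ ^ 2 = ∑ i, ‖z i‖ ^ 2 := by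
  have h := star_mulVec_dotProduct_mulVec_unitary hU z
  rw [← sum_sq_norm_eq_re_star_dotProduct, ← sum_sq_norm_eq_re_star_dotProduct] at h
  exact_mod_cast h

theorem measurePreserving_unitary_mulVec {n : ℕ} {U : Matrix (Fin n) (Fin n) ℂ}
    (hU : U ∈ unitaryGroup (Fin n) ℂ) :
    MeasurePreserving (fun z : Fin n → ℂ => U *ᵥ z) volume volume := by
  have hU1 : star U * U = 1 := (Unitary.mem_iff.1 hU).1
  have hU2 : U * star U = 1 := (Unitary.mem_iff.1 hU).2
  let L : (Fin n → ℂ) →ₗ[ℝ] (Fin n → ℂ) := (mulVecLin U).restrictScalars ℝ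
  let S : Set (Fin n → ℂ) := {z | ∑ i, ‖z i‖ ^ 2 < 1}
  have hopen : IsOpen S := isOpen_lt (by fun_prop) continuous_const
  have himg : L '' S = S := by
    ext z
    constructor
    · rintro ⟨w, hw, rfl⟩
      change ∑ i, ‖(U *ᵥ w) i‖ ^ 2 < 1
      rw [sum_sq_norm_unitary_mulVec hU1]
      exact hw
    · intro hz
      refine ⟨star U *ᵥ z, ?_, ?_⟩
      · change ∑ i, ‖(star U *ᵥ z) i‖ ^ 2 < 1
        rw [sum_sq_norm_unitary_mulVec (by rwa [star_star])]
        exact hz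
      · change U *ᵥ (star U *ᵥ z) = z
        rw [mulVec_mulVec, hU2, one_mulVec]
  have h0 : volume S ≠ 0 := (hopen.measure_pos volume ⟨0, by simp [S]⟩).ne'
  have hb : S ⊆ Metric.closedBall 0 1 := by
    intro z hz
    rw [mem_closedBall_zero_iff, pi_norm_le_iff_of_nonneg zero_le_one]
    intro i
    have h1 : ‖z i‖ ^ 2 ≤ ∑ i, ‖z i‖ ^ 2 :=
      Finset.single_le_sum (f := fun i => ‖z i‖ ^ 2) (fun _ _ => by positivity) (Finset.mem_univ i)
    have h2 : ∑ i, ‖z i‖ ^ 2 < 1 := hz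
    nlinarith [norm_nonneg (z i)]
  have htop : volume S ≠ ⊤ :=
    ((measure_mono hb).trans_lt (isCompact_closedBall _ _).measure_lt_top).ne
  have hdet := abs_det_eq_one_of_image_eq volume L himg h0 htop
  have hne : LinearMap.det L ≠ 0 := by
    intro h
    simp [h] at hdet
  refine ⟨(L.continuous_of_finiteDimensional).measurable, ?_⟩
  have := Measure.map_linearMap_addHaar_eq_smul_addHaar (volume : Measure (Fin n → ℂ)) hne
  rw [abs_inv, hdet, inv_one, ENNReal.ofReal_one, one_smul] at this
  exact this

theorem integral_unitary_mulVec {n : ℕ} {U : Matrix (Fin n) (Fin n) ℂ}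
    (hU : U ∈ unitaryGroup (Fin n) ℂ) (f : (Fin n → ℂ) → ℂ) :
    ∫ z, f (U *ᵥ z) = ∫ z, f z := by
  refine (measurePreserving_unitary_mulVec hU).integral_comp ?_ f
  have hc : Continuous (fun z : Fin n → ℂ => U *ᵥ z) := by fun_prop
  refine hc.measurableEmbedding (fun z w h => ?_)
  have h' : star U *ᵥ (U *ᵥ z) = star U *ᵥ (U *ᵥ w) := congrArg _ h
  rwa [mulVec_mulVec, mulVec_mulVec, (Unitary.mem_iff.1 hU).1, one_mulVec, one_mulVec] at h'

theorem measurePreserving_sq_norm :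
    MeasurePreserving (fun z : ℂ => ‖z‖ ^ 2) volume
      (ENNReal.ofReal Real.pi • volume.restrict (Set.Ioi (0 : ℝ))) := by
  have hm : Measurable (fun z : ℂ => ‖z‖ ^ 2) := by fun_prop
  refine ⟨hm, ?_⟩
  have key : ∀ a : ℝ, Measure.map (fun z : ℂ => ‖z‖ ^ 2) volume (Set.Iio a) =
      ENNReal.ofReal a * NNReal.pi := by
    intro a
    have hset : (fun z : ℂ => ‖z‖ ^ 2) ⁻¹' Set.Iio a = Metric.ball 0 √a := by
      ext z
      simp [Real.lt_sqrt (norm_nonneg z)]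
    rw [Measure.map_apply hm measurableSet_Iio, hset, Complex.volume_ball,
      ← ENNReal.ofReal_pow (Real.sqrt_nonneg a)]
    congr 1
    rcases le_total 0 a with h | h
    · rw [Real.sq_sqrt h]
    · simp [Real.sqrt_eq_zero_of_nonpos h, ENNReal.ofReal_of_nonpos h]
  refine Measure.ext_of_generateFrom_of_iUnion (Set.range Set.Iio) (fun k : ℕ => Set.Iio (k : ℝ))
    ?_ isPiSystem_Iio ?_ (fun k => ⟨_, rfl⟩) ?_ ?_
  · rw [← borel_eq_generateFrom_Iio]; exact BorelSpace.measurable_eq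
  · exact Set.iUnion_eq_univ_iff.2 fun x => (exists_nat_gt x)
  · intro k
    rw [key]
    exact ENNReal.mul_ne_top ENNReal.ofReal_ne_top ENNReal.coe_ne_top
  · rintro _ ⟨a, rfl⟩
    rw [key, Measure.smul_apply, Measure.restrict_apply measurableSet_Iio, Set.inter_comm,
      Set.Ioi_inter_Iio, Real.volume_Ioo, sub_zero, smul_eq_mul, mul_comm]
    congr 1
    rw [← NNReal.coe_real_pi, ENNReal.ofReal_coe_nnreal]

theorem integral_comp_sq_norm {n : ℕ} {f : (Fin n → ℝ) → ℂ} (hf : Continuous f) :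
    ∫ z : Fin n → ℂ, f (fun i => ‖z i‖ ^ 2) =
      (Real.pi : ℂ) ^ n * ∫ r in Set.univ.pi fun _ : Fin n => Set.Ioi (0 : ℝ), f r := by
  have hmp := measurePreserving_pi (fun _ : Fin n => (volume : Measure ℂ))
    (fun _ => ENNReal.ofReal Real.pi • volume.restrict (Set.Ioi (0 : ℝ)))
    (f := fun _ z => ‖z‖ ^ 2) (hν := fun _ => by
      rw [← NNReal.coe_real_pi, ENNReal.ofReal_coe_nnreal]
      change SigmaFinite (NNReal.pi • volume.restrict (Set.Ioi (0 : ℝ)))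
      infer_instance) (fun _ => measurePreserving_sq_norm)
  have hpi : Measure.pi (fun _ : Fin n =>
      ENNReal.ofReal Real.pi • volume.restrict (Set.Ioi (0 : ℝ))) =
      ENNReal.ofReal Real.pi ^ n •
        (volume : Measure (Fin n → ℝ)).restrict (Set.univ.pi fun _ : Fin n => Set.Ioi (0 : ℝ)) := by
    have : SigmaFinite (ENNReal.ofReal Real.pi • volume.restrict (Set.Ioi (0 : ℝ))) := by
      rw [← NNReal.coe_real_pi, ENNReal.ofReal_coe_nnreal]
      change SigmaFinite (NNReal.pi • volume.restrict (Set.Ioi (0 : ℝ)))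
      infer_instance
    refine Measure.pi_eq fun s hs => ?_
    rw [volume_pi, Measure.restrict_pi_pi, Measure.smul_apply, Measure.pi_pi]
    simp [Finset.prod_mul_distrib]
  have h1 := hmp.map_eq
  rw [hpi] at h1
  have h2 : ∫ z : Fin n → ℂ, f (fun i => ‖z i‖ ^ 2) =
      ∫ r, f r ∂(Measure.map (fun (z : Fin n → ℂ) i => ‖z i‖ ^ 2)
        (Measure.pi fun _ : Fin n => (volume : Measure ℂ))) := by
    rw [integral_map hmp.measurable.aemeasurable hf.aestronglyMeasurable]
    rfl
  rw [h2, h1, integral_smul_measure]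
  simp [ENNReal.toReal_ofReal Real.pi_pos.le, Complex.real_smul]

/-- The interval of values which the `k`-th point of a sequence interlacing `x` from below can
take. -/
def interlacingInterval {n : ℕ} (x : Fin n → ℝ) (k : Fin n) : Set ℝ :=
  {t | t < x k ∧ ∀ j, j < k → x j < t}

/-- The sequences interlacing `x` from below. -/
def interlacingBox {n : ℕ} (x : Fin n → ℝ) : Set (Fin n → ℝ) :=
  Set.univ.pi fun k => interlacingInterval x k

/-- The weights `r` for which `diag(x) - w w*` with `|w j|² = r j` has spectrum `y`. -/
noncomputable def rankOneWeight {n : ℕ} (x y : Fin n → ℝ) (j : Fin n) : ℝ :=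
  (∏ k, (x j - y k)) / ∏ k ∈ Finset.univ.erase j, (x j - x k)

/-- The characteristic polynomial of `diag(x) - w w*` with `|w j|² = r j`. -/
noncomputable def rankOnePoly {n : ℕ} (x r : Fin n → ℝ) : Polynomial ℝ :=
  ∏ k, (Polynomial.X - Polynomial.C (x k)) +
    ∑ j, Polynomial.C (r j) * ∏ k ∈ Finset.univ.erase j, (Polynomial.X - Polynomial.C (x k))

theorem mem_interlacingBox {n : ℕ} {x y : Fin n → ℝ} :
    y ∈ interlacingBox x ↔ ∀ k, y k < x k ∧ ∀ j, j < k → x j < y k := by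
  simp [interlacingBox, interlacingInterval, Set.mem_pi]

theorem strictMono_of_mem_interlacingBox {n : ℕ} {x y : Fin n → ℝ} (hy : y ∈ interlacingBox x) :
    StrictMono y := by
  rw [mem_interlacingBox] at hy
  exact fun i j hij => (hy i).1.trans ((hy j).2 i hij)

theorem rankOneWeight_eq {n : ℕ} (x y : Fin n → ℝ) (j : Fin n) :
    rankOneWeight x y j =
      (x j - y j) * ∏ k ∈ Finset.univ.erase j, ((x j - y k) / (x j - x k)) := by
  rw [rankOneWeight, ← Finset.mul_prod_erase _ _ (Finset.mem_univ j), Finset.prod_div_distrib,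
    mul_div_assoc]

theorem rankOneWeight_pos {n : ℕ} {x y : Fin n → ℝ} (hx : StrictMono x)
    (hy : y ∈ interlacingBox x) (j : Fin n) : 0 < rankOneWeight x y j := by
  rw [rankOneWeight_eq]
  rw [mem_interlacingBox] at hy
  refine mul_pos (sub_pos.2 (hy j).1) (Finset.prod_pos fun k hk => ?_)
  rcases lt_or_gt_of_ne (Finset.ne_of_mem_erase hk) with h | h
  · exact div_pos (sub_pos.2 ((hy k).1.trans (hx h))) (sub_pos.2 (hx h))
  · exact div_pos_of_neg_of_neg (sub_neg.2 ((hy k).2 j h)) (sub_neg.2 (hx h))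

theorem eval_rankOnePoly_self {n : ℕ} (x r : Fin n → ℝ) (j : Fin n) :
    (rankOnePoly x r).eval (x j) = r j * ∏ k ∈ Finset.univ.erase j, (x j - x k) := by
  simp only [rankOnePoly, Polynomial.eval_add, Polynomial.eval_prod, Polynomial.eval_sub,
    Polynomial.eval_X, Polynomial.eval_C, Polynomial.eval_finsetSum, Polynomial.eval_mul]
  rw [Finset.prod_eq_zero (Finset.mem_univ j) (sub_self _), zero_add,
    Finset.sum_eq_single j _ (by simp)]
  intro i _ hij
  rw [Finset.prod_eq_zero (Finset.mem_erase.2 ⟨hij.symm, Finset.mem_univ j⟩) (sub_self _),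
    mul_zero]

theorem degree_rankOnePoly_sub_lt {n : ℕ} (x r y : Fin n → ℝ) :
    (rankOnePoly x r - ∏ k, (Polynomial.X - Polynomial.C (y k))).degree < (n : WithBot ℕ) := by
  have h1 : (∑ j, Polynomial.C (r j) *
      ∏ k ∈ Finset.univ.erase j, (Polynomial.X - Polynomial.C (x k))).degree < (n : WithBot ℕ) := by
    refine Polynomial.mem_degreeLT.1 (Submodule.sum_mem _ fun j _ => Polynomial.mem_degreeLT.2 ?_)
    rw [← Polynomial.smul_eq_C_mul]
    refine lt_of_le_of_lt (Polynomial.degree_smul_le _ _) ?_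
    rw [Polynomial.degree_prod]
    simp only [Polynomial.degree_X_sub_C, Finset.sum_const, Finset.card_erase_of_mem
      (Finset.mem_univ j), Finset.card_univ, Fintype.card_fin]
    have : 0 < n := j.pos
    rw [nsmul_one]
    exact_mod_cast Nat.sub_lt this one_pos
  have h2 : ((∏ k, (Polynomial.X - Polynomial.C (x k))) -
      ∏ k, (Polynomial.X - Polynomial.C (y k))).degree < (n : WithBot ℕ) := by
    have hd : ∀ z : Fin n → ℝ, (∏ k, (Polynomial.X - Polynomial.C (z k))).degree = (n : WithBot ℕ) := by
      intro z
      rw [Polynomial.degree_prod]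
      simp
    have hm : ∀ z : Fin n → ℝ, (∏ k, (Polynomial.X - Polynomial.C (z k))).Monic :=
      fun z => Polynomial.monic_prod_of_monic _ _ fun k _ => Polynomial.monic_X_sub_C _
    have := Polynomial.degree_sub_lt_left ((hd x).trans (hd y).symm) (hm x).ne_zero
      (by rw [(hm x).leadingCoeff, (hm y).leadingCoeff])
    rwa [hd] at this
  rw [rankOnePoly, add_sub_right_comm]
  exact lt_of_le_of_lt (Polynomial.degree_add_le _ _) (max_lt h2 h1)

theorem prod_sub_ne_zero_of_injective {n : ℕ} {x : Fin n → ℝ} (hx : Function.Injective x)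
    (j : Fin n) : ∏ k ∈ Finset.univ.erase j, (x j - x k) ≠ 0 :=
  Finset.prod_ne_zero_iff.2 fun _ hk => sub_ne_zero.2 (hx.ne (Finset.ne_of_mem_erase hk).symm)

theorem rankOnePoly_rankOneWeight {n : ℕ} {x : Fin n → ℝ} (hx : Function.Injective x)
    (y : Fin n → ℝ) :
    rankOnePoly x (rankOneWeight x y) = ∏ k, (Polynomial.X - Polynomial.C (y k)) := by
  refine Polynomial.eq_of_degree_sub_lt_of_eval_index_eq (v := x) Finset.univ hx.injOn
    (by simpa using degree_rankOnePoly_sub_lt x _ y) fun j _ => ?_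
  rw [eval_rankOnePoly_self, rankOneWeight, div_mul_cancel₀ _ (prod_sub_ne_zero_of_injective hx j)]
  simp [Polynomial.eval_prod]

theorem rankOneWeight_injOn {n : ℕ} {x : Fin n → ℝ} (hx : Function.Injective x) :
    Set.InjOn (rankOneWeight x) (interlacingBox x) := by
  intro y hy z hz h
  have hp : ∏ k, (Polynomial.X - Polynomial.C (y k)) = ∏ k, (Polynomial.X - Polynomial.C (z k)) := by
    rw [← rankOnePoly_rankOneWeight hx, ← rankOnePoly_rankOneWeight hx, h]
  have hr : Set.range y = Set.range z := by
    ext t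
    have := congrArg (Polynomial.eval t) hp
    simp only [Polynomial.eval_prod, Polynomial.eval_sub, Polynomial.eval_X,
      Polynomial.eval_C] at this
    have h2 : (∏ k, (t - y k) = 0) ↔ (∏ k, (t - z k) = 0) := by rw [this]
    simpa only [Finset.prod_eq_zero_iff, sub_eq_zero, Finset.mem_univ, true_and, Set.mem_range,
      eq_comm (a := t)] using h2
  exact (StrictMono.range_inj (strictMono_of_mem_interlacingBox hy)
    (strictMono_of_mem_interlacingBox hz)).1 hr

theorem neg_one_pow_card_mul_prod_pos {n : ℕ} {x : Fin n → ℝ} (hx : StrictMono x) (j : Fin n) :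
    0 < (-1) ^ (n - 1 - (j : ℕ)) * ∏ k ∈ Finset.univ.erase j, (x j - x k) := by
  have hcard : n - 1 - (j : ℕ) = (Finset.Ioi j).card := by rw [Fin.card_Ioi]
  have hsplit : Finset.univ.erase j = Finset.Iio j ∪ Finset.Ioi j := by
    ext k
    simp [lt_or_lt_iff_ne]
  rw [hsplit, Finset.prod_union (Finset.disjoint_left.2 fun k h1 h2 =>
    lt_asymm (Finset.mem_Iio.1 h1) (Finset.mem_Ioi.1 h2)), hcard, ← Finset.prod_const,
    mul_left_comm, ← Finset.prod_mul_distrib]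
  refine mul_pos (Finset.prod_pos fun k hk => sub_pos.2 (hx (Finset.mem_Iio.1 hk)))
    (Finset.prod_pos fun k hk => ?_)
  have := hx (Finset.mem_Ioi.1 hk)
  linarith

theorem exists_lt_neg_one_pow_mul_eval_rankOnePoly_pos {n : ℕ} {x r : Fin n → ℝ}
    (hr : ∀ j, 0 < r j) : ∃ L : ℝ, (∀ j, L < x j) ∧
      0 < (-1) ^ n * (rankOnePoly x r).eval L := by
  obtain ⟨B, hB⟩ := (Set.finite_range x).bddBelow
  have hB' : ∀ j, B ≤ x j := fun j => hB ⟨j, rfl⟩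
  have hs : 0 ≤ ∑ j, r j := Finset.sum_nonneg fun j _ => (hr j).le
  set s := ∑ j, r j with hsdef
  set L := B - s - 1 with hL
  have hlt : ∀ j, s + 1 ≤ x j - L := fun j => by have := hB' j; linarith
  have hpos : ∀ j, 0 < x j - L := fun j => by have := hlt j; linarith
  refine ⟨L, fun j => sub_pos.1 (hpos j), ?_⟩
  have heval : (-1) ^ n * (rankOnePoly x r).eval L =
      (∏ k, (x k - L)) * (1 - ∑ j, r j / (x j - L)) := by
    simp only [rankOnePoly, Polynomial.eval_add, Polynomial.eval_prod, Polynomial.eval_sub,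
      Polynomial.eval_X, Polynomial.eval_C, Polynomial.eval_finsetSum, Polynomial.eval_mul]
    have h1 : ∏ k, (L - x k) = (-1) ^ n * ∏ k, (x k - L) := by
      have : ∏ _k : Fin n, (-1 : ℝ) = (-1) ^ n := by simp
      rw [← this, ← Finset.prod_mul_distrib]
      exact Finset.prod_congr rfl fun k _ => by ring
    have h2 : ∀ j, r j * ∏ k ∈ Finset.univ.erase j, (L - x k) =
        -(r j / (x j - L)) * ∏ k, (L - x k) := by
      intro j
      rw [← Finset.mul_prod_erase _ _ (Finset.mem_univ j)]
      have := (hpos j).ne'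
      field_simp
      ring
    rw [Finset.sum_congr rfl fun j _ => h2 j, ← Finset.sum_mul, h1, Finset.sum_neg_distrib]
    have h3 : ((-1 : ℝ) ^ n) * (-1) ^ n = 1 := by rw [← mul_pow]; simp
    linear_combination (∏ k, (x k - L)) * (1 - ∑ j, r j / (x j - L)) * h3
  rw [heval]
  refine mul_pos (Finset.prod_pos fun k _ => hpos k) (sub_pos.2 ?_)
  have h4 : ∑ j, r j / (x j - L) ≤ ∑ j, r j / (s + 1) :=
    Finset.sum_le_sum fun j _ => div_le_div_of_nonneg_left (hr j).le (by linarith) (hlt j)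
  refine h4.trans_lt ?_
  rw [← Finset.sum_div, div_lt_one (by linarith)]
  linarith

theorem exists_mem_Ioo_eval_eq_zero {p : Polynomial ℝ} {a b s : ℝ} (hab : a < b)
    (ha : s * p.eval a < 0) (hb : 0 < s * p.eval b) : ∃ t ∈ Set.Ioo a b, p.eval t = 0 := by
  have hc : ContinuousOn (fun t => s * p.eval t) (Set.Icc a b) := by fun_prop
  obtain ⟨t, ht, h0⟩ := intermediate_value_Ioo hab.le hc ⟨ha, hb⟩
  refine ⟨t, ht, ?_⟩
  have hs : s ≠ 0 := by
    rintro rfl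
    simp at ha
  exact (mul_eq_zero.1 h0).resolve_left hs

theorem exists_interlacing_root {n : ℕ} {x r : Fin n → ℝ} (hx : StrictMono x)
    (hr : ∀ j, 0 < r j) (k : Fin n) :
    ∃ t ∈ interlacingInterval x k, (rankOnePoly x r).eval t = 0 := by
  have hsign : ∀ j : Fin n, 0 < (-1) ^ (n - 1 - (j : ℕ)) * (rankOnePoly x r).eval (x j) := by
    intro j
    rw [eval_rankOnePoly_self, mul_left_comm]
    exact mul_pos (hr j) (neg_one_pow_card_mul_prod_pos hx j)
  have hk := k.isLt
  by_cases h0 : (k : ℕ) = 0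
  · obtain ⟨L, hL, hpos⟩ := exists_lt_neg_one_pow_mul_eval_rankOnePoly_pos (x := x) hr
    have h1 := hsign k
    have hn : n = (n - 1 - (k : ℕ)) + 1 := by omega
    have h2 : (-1) ^ (n - 1 - (k : ℕ)) * (rankOnePoly x r).eval L < 0 := by
      rw [show ((-1 : ℝ)) ^ n = (-1) ^ ((n - 1 - (k : ℕ)) + 1) by rw [← hn], pow_succ] at hpos
      linarith
    obtain ⟨t, ht, h⟩ := exists_mem_Ioo_eval_eq_zero (hL k) h2 h1
    refine ⟨t, ⟨ht.2, fun j hj => ?_⟩, h⟩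
    rw [Fin.lt_def] at hj
    omega
  · let i : Fin n := ⟨k - 1, by omega⟩
    have hik : i < k := by rw [Fin.lt_def]; simp only [i]; omega
    have h1 := hsign k
    have h2 := hsign i
    have hi : n - 1 - (i : ℕ) = (n - 1 - (k : ℕ)) + 1 := by simp only [i]; omega
    rw [hi, pow_succ] at h2
    obtain ⟨t, ht, h⟩ := exists_mem_Ioo_eval_eq_zero (hx hik) (by linarith) h1
    refine ⟨t, ⟨ht.2, fun j hj => lt_of_le_of_lt (hx.monotone ?_) ht.1⟩, h⟩
    rw [Fin.lt_def] at hj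
    rw [Fin.le_def]
    simp only [i]
    omega

theorem rankOneWeight_image_interlacingBox {n : ℕ} {x : Fin n → ℝ} (hx : StrictMono x) :
    rankOneWeight x '' interlacingBox x = Set.univ.pi fun _ => Set.Ioi 0 := by
  refine Set.Subset.antisymm ?_ fun r hr => ?_
  · rintro _ ⟨y, hy, rfl⟩ j _
    exact rankOneWeight_pos hx hy j
  · have hr' : ∀ j, 0 < r j := fun j => hr j (Set.mem_univ j)
    choose y hy h0 using exists_interlacing_root hx hr'
    have hyB : y ∈ interlacingBox x := fun k _ => hy k
    refine ⟨y, hyB, ?_⟩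
    have hp : rankOnePoly x r = ∏ k, (Polynomial.X - Polynomial.C (y k)) := by
      refine Polynomial.eq_of_degree_sub_lt_of_eval_index_eq (v := y) Finset.univ
        (strictMono_of_mem_interlacingBox hyB).injective.injOn
        (by simpa using degree_rankOnePoly_sub_lt x r y) fun j _ => ?_
      rw [h0, Polynomial.eval_prod, Finset.prod_eq_zero (Finset.mem_univ j) (by simp)]
    funext j
    have := congrArg (Polynomial.eval (x j)) hp
    rw [eval_rankOnePoly_self, Polynomial.eval_prod] at this
    simp only [Polynomial.eval_sub, Polynomial.eval_X, Polynomial.eval_C] at this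
    rw [rankOneWeight, ← this, mul_div_cancel_right₀ _ (prod_sub_ne_zero_of_injective hx.injective j)]

theorem det_diagonal_add_vecMulVec {n : ℕ} {d : Fin n → ℂ} (hd : ∀ k, d k ≠ 0)
    (u v : Fin n → ℂ) :
    (diagonal d + vecMulVec u v).det =
      ∏ k, d k + ∑ j, (u j * v j) * ∏ k ∈ Finset.univ.erase j, d k := by
  have h1 : diagonal d + vecMulVec u v =
      diagonal d * (1 + replicateCol Unit (fun k => (d k)⁻¹ * u k) * replicateRow Unit v) := by
    rw [mul_add, mul_one]
    congr 1
    ext i j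
    rw [diagonal_mul, mul_apply]
    simp only [vecMulVec_apply, replicateCol_apply, replicateRow_apply, Finset.univ_unique,
      Finset.sum_singleton]
    rw [mul_assoc, mul_inv_cancel_left₀ (hd i)]
  rw [h1, det_mul, det_diagonal, det_one_add_replicateCol_mul_replicateRow, mul_add, mul_one,
    dotProduct, Finset.mul_sum]
  congr 1
  refine Finset.sum_congr rfl fun j _ => ?_
  rw [← Finset.mul_prod_erase _ _ (Finset.mem_univ j)]
  have := hd j
  field_simp

theorem charpoly_diagonal_sub_vecMulVec {n : ℕ} (x : Fin n → ℝ) (w : Fin n → ℂ) :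
    (diagonal (fun k => (x k : ℂ)) - vecMulVec w (star w)).charpoly =
      (rankOnePoly x fun j => ‖w j‖ ^ 2).map (algebraMap ℝ ℂ) := by
  refine Polynomial.eq_of_infinite_eval_eq _ _
    (Set.Infinite.mono ?_ (Set.finite_range fun k => (x k : ℂ)).infinite_compl)
  intro t ht
  have hd : ∀ k, t - x k ≠ 0 := fun k h => ht ⟨k, (sub_eq_zero.1 h).symm⟩
  rw [Set.mem_ofPred_eq, eval_charpoly]
  have h1 : scalar (Fin n) t - (diagonal (fun k => (x k : ℂ)) - vecMulVec w (star w)) =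
      diagonal (fun k => t - x k) + vecMulVec w (star w) := by
    rw [scalar_apply, sub_sub_eq_add_sub, add_sub_right_comm, diagonal_sub]
  rw [h1, det_diagonal_add_vecMulVec hd]
  simp only [rankOnePoly, Polynomial.map_add, Polynomial.map_prod, Polynomial.map_sub,
    Polynomial.map_X, Polynomial.map_C, Polynomial.map_sum, Polynomial.map_mul,
    Polynomial.eval_add, Polynomial.eval_prod, Polynomial.eval_sub,
    Polynomial.eval_X, Polynomial.eval_C, Polynomial.eval_finsetSum, Polynomial.eval_mul]
  simp [Complex.mul_conj']

theorem abs_prod_prod_erase_sub {n : ℕ} (y : Fin n → ℝ) :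
    |∏ j, ∏ k ∈ Finset.univ.erase j, (y j - y k)| = (vandermonde y).det ^ 2 := by
  have hsplit : ∀ j : Fin n, Finset.univ.erase j = Finset.Iio j ∪ Finset.Ioi j := by
    intro j
    ext k
    simp [lt_or_lt_iff_ne]
  have h1 : ∀ j, ∏ k ∈ Finset.univ.erase j, (y j - y k) =
      (∏ k ∈ Finset.Iio j, (y j - y k)) * ∏ k ∈ Finset.Ioi j, (y j - y k) := fun j => by
    rw [hsplit, Finset.prod_union (Finset.disjoint_left.2 fun k h1 h2 =>
      lt_asymm (Finset.mem_Iio.1 h1) (Finset.mem_Ioi.1 h2))]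
  have h2 : ∏ j, ∏ k ∈ Finset.Iio j, (y j - y k) = ∏ j, ∏ k ∈ Finset.Ioi j, (y k - y j) :=
    Finset.prod_comm' (by simp)
  rw [Finset.prod_congr rfl fun j _ => h1 j, Finset.prod_mul_distrib, h2, det_vandermonde, abs_mul,
    sq, ← abs_mul_abs_self (∏ i, ∏ j ∈ Finset.Ioi i, (y j - y i))]
  congr 1
  simp only [Finset.abs_prod]
  exact Finset.prod_congr rfl fun j _ => Finset.prod_congr rfl fun k _ => abs_sub_comm _ _

theorem abs_det_prod_erase_sub {n : ℕ} (x y : Fin n → ℝ) (hy : Function.Injective y) :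
    |(of fun j k => ∏ l ∈ Finset.univ.erase k, (x j - y l) : Matrix (Fin n) (Fin n) ℝ).det| =
      |(vandermonde x).det| * |(vandermonde y).det| := by
  let p : Fin n → Polynomial ℝ := fun k =>
    ∏ l ∈ Finset.univ.erase k, (Polynomial.X - Polynomial.C (y l))
  let B : Matrix (Fin n) (Fin n) ℝ := of fun m k => (p k).coeff m
  have hdeg : ∀ k, (p k).natDegree < n := by
    intro k
    rw [Polynomial.natDegree_finsetProd_X_sub_C_eq_card]
    rw [Finset.card_erase_of_mem (Finset.mem_univ k), Finset.card_univ, Fintype.card_fin]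
    exact Nat.sub_lt k.pos one_pos
  have hfac : ∀ z : Fin n → ℝ,
      (of fun j k => ∏ l ∈ Finset.univ.erase k, (z j - y l) : Matrix (Fin n) (Fin n) ℝ) =
        vandermonde z * B := by
    intro z
    ext j k
    have h1 : ∏ l ∈ Finset.univ.erase k, (z j - y l) = (p k).eval (z j) := by
      simp [p, Polynomial.eval_prod]
    rw [of_apply, h1, Polynomial.eval_eq_sum_range' (hdeg k), mul_apply,
      Finset.sum_range fun i => (p k).coeff i * z j ^ i]
    exact Finset.sum_congr rfl fun m _ => mul_comm _ _
  have hdiag : (of fun j k => ∏ l ∈ Finset.univ.erase k, (y j - y l) :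
      Matrix (Fin n) (Fin n) ℝ) = diagonal fun j => ∏ l ∈ Finset.univ.erase j, (y j - y l) := by
    ext j k
    by_cases h : j = k
    · subst h
      simp
    · rw [diagonal_apply_ne _ h, of_apply]
      exact Finset.prod_eq_zero (Finset.mem_erase.2 ⟨h, Finset.mem_univ j⟩) (sub_self _)
  have hB : |B.det| = |(vandermonde y).det| := by
    have h1 : |(vandermonde y).det| * |B.det| =
        |(vandermonde y).det| * |(vandermonde y).det| := by
      rw [← abs_mul, ← det_mul, ← hfac, hdiag, det_diagonal, abs_prod_prod_erase_sub,
        abs_mul_abs_self, sq]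
    exact mul_left_cancel₀ (abs_ne_zero.2 (det_vandermonde_ne_zero_iff.2 hy)) h1
  rw [hfac, det_mul, abs_mul, hB]

/-- The Jacobian matrix of `rankOneWeight x`. -/
noncomputable def rankOneJacobian {n : ℕ} (x y : Fin n → ℝ) : Matrix (Fin n) (Fin n) ℝ :=
  of fun j k => (-(∏ i ∈ Finset.univ.erase j, (x j - x i))⁻¹) *
    ∏ l ∈ Finset.univ.erase k, (x j - y l)

theorem abs_det_rankOneJacobian {n : ℕ} {x y : Fin n → ℝ} (hx : Function.Injective x)
    (hy : Function.Injective y) :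
    |(rankOneJacobian x y).det| = |(vandermonde y).det| / |(vandermonde x).det| := by
  have h1 : rankOneJacobian x y = of fun j k =>
      (-(∏ i ∈ Finset.univ.erase j, (x j - x i))⁻¹) *
        (of fun j k => ∏ l ∈ Finset.univ.erase k, (x j - y l) : Matrix (Fin n) (Fin n) ℝ) j k := rfl
  have hV : |(vandermonde x).det| ≠ 0 := abs_ne_zero.2 (det_vandermonde_ne_zero_iff.2 hx)
  rw [h1, det_mul_column, abs_mul, abs_det_prod_erase_sub x y hy, Finset.abs_prod]
  simp only [abs_neg, abs_inv]
  rw [Finset.prod_inv_distrib, ← Finset.abs_prod, abs_prod_prod_erase_sub, ← sq_abs]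
  field_simp

theorem hasFDerivAt_rankOneWeight {n : ℕ} (x y : Fin n → ℝ) :
    HasFDerivAt (rankOneWeight x)
      (LinearMap.toContinuousLinearMap (toLin' (rankOneJacobian x y))) y := by
  rw [hasFDerivAt_pi']
  intro j
  have h : ∀ k ∈ (Finset.univ : Finset (Fin n)), HasFDerivAt (fun y : Fin n → ℝ => x j - y k)
      (-(ContinuousLinearMap.proj k : (Fin n → ℝ) →L[ℝ] ℝ)) y :=
    fun k _ => (hasFDerivAt_apply k y).const_sub (x j)
  have h1 := (HasFDerivAt.finsetProd h).mul_const
    (∏ i ∈ Finset.univ.erase j, (x j - x i))⁻¹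
  refine h1.congr_fderiv ?_
  ext v
  simp [toLin'_apply, mulVec, dotProduct, rankOneJacobian, Finset.mul_sum]
  refine Finset.sum_congr rfl fun k _ => ?_
  ring

theorem det_vandermonde_pos {n : ℕ} {x : Fin n → ℝ} (hx : StrictMono x) :
    0 < (vandermonde x).det := by
  rw [det_vandermonde]
  exact Finset.prod_pos fun i _ => Finset.prod_pos fun j hj =>
    sub_pos.2 (hx (Finset.mem_Ioi.1 hj))

theorem measurableSet_interlacingInterval {n : ℕ} (x : Fin n → ℝ) (k : Fin n) :
    MeasurableSet (interlacingInterval x k) := by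
  have : interlacingInterval x k = Set.Iio (x k) ∩ ⋂ j, ⋂ (_ : j < k), Set.Ioi (x j) := by
    ext t
    simp [interlacingInterval]
  rw [this]
  exact measurableSet_Iio.inter
    (MeasurableSet.iInter fun j => MeasurableSet.iInter fun _ => measurableSet_Ioi)

theorem integral_pi_Ioi_eq_integral_interlacingBox {n : ℕ} {x : Fin n → ℝ} (hx : StrictMono x)
    (f : (Fin n → ℝ) → ℂ) :
    ∫ r in Set.univ.pi fun _ : Fin n => Set.Ioi (0 : ℝ), f r =
      ((vandermonde x).det : ℂ)⁻¹ *
        ∫ y in interlacingBox x, ((vandermonde y).det : ℂ) * f (rankOneWeight x y) := by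
  have hmeas : MeasurableSet (interlacingBox x) :=
    MeasurableSet.univ_pi fun k => measurableSet_interlacingInterval x k
  rw [← rankOneWeight_image_interlacingBox hx,
    integral_image_eq_integral_abs_det_fderiv_smul volume hmeas
      (fun y _ => (hasFDerivAt_rankOneWeight x y).hasFDerivWithinAt)
      (rankOneWeight_injOn hx.injective), ← integral_const_mul]
  refine setIntegral_congr_fun hmeas fun y hy => ?_
  have hy' := strictMono_of_mem_interlacingBox hy
  have hdet : (LinearMap.toContinuousLinearMap (toLin' (rankOneJacobian x y))).det =
      (rankOneJacobian x y).det := by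
    rw [LinearMap.det_toContinuousLinearMap, LinearMap.det_toLin']
  rw [hdet, abs_det_rankOneJacobian hx.injective hy'.injective, abs_of_pos (det_vandermonde_pos hx),
    abs_of_pos (det_vandermonde_pos hy'), Complex.real_smul]
  push_cast
  ring

/-- `Φ` is given on Hermitian matrices with simple spectrum `x` by
`c * det[h i (x j)] / ∏ i < j, (x j - x i)`. -/
def HasDetForm {n : ℕ} (Φ : Matrix (Fin n) (Fin n) ℂ → ℂ) (h : Fin n → ℝ → ℂ) (c : ℂ) : Prop :=
  ∀ X : Matrix (Fin n) (Fin n) ℂ, X.IsHermitian → ∀ x : Fin n → ℝ, Function.Injective x →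
    X.charpoly = ∏ j, (Polynomial.X - Polynomial.C (x j : ℂ)) →
      Φ X * ((vandermonde x).det : ℂ) = c * (of fun i j => h i (x j)).det

theorem hasDetForm_of_strictMono {n : ℕ} {Φ : Matrix (Fin n) (Fin n) ℂ → ℂ}
    {h : Fin n → ℝ → ℂ} {c : ℂ}
    (H : ∀ X : Matrix (Fin n) (Fin n) ℂ, X.IsHermitian → ∀ x : Fin n → ℝ, StrictMono x →
      X.charpoly = ∏ j, (Polynomial.X - Polynomial.C (x j : ℂ)) →
        Φ X * ((vandermonde x).det : ℂ) = c * (of fun i j => h i (x j)).det) :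
    HasDetForm Φ h c := by
  intro X hX x hx hchar
  let σ := Tuple.sort x
  have hmono : StrictMono (x ∘ σ) :=
    (Tuple.monotone_sort x).strictMono_of_injective (hx.comp σ.injective)
  have h1 := H X hX (x ∘ σ) hmono
    (by rw [hchar]; exact (Equiv.prod_comp σ fun j => Polynomial.X - Polynomial.C (x j : ℂ)).symm)
  have h2 : (vandermonde (x ∘ σ)).det = Equiv.Perm.sign σ * (vandermonde x).det := by
    rw [← det_permute]
    rfl
  have h3 : (of fun i j => h i ((x ∘ σ) j)).det =
      Equiv.Perm.sign σ * (of fun i j => h i (x j)).det := by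
    rw [← det_permute']
    rfl
  rw [h2, h3] at h1
  rcases Int.units_eq_one_or (Equiv.Perm.sign σ) with hs | hs
  · simpa [hs] using h1
  · rw [hs] at h1
    push_cast at h1
    linear_combination -h1

theorem exists_unitary_eq_conj_diagonal {n : ℕ} {X : Matrix (Fin n) (Fin n) ℂ}
    (hX : X.IsHermitian) {x : Fin n → ℝ} (hx : Function.Injective x)
    (hchar : X.charpoly = ∏ j, (Polynomial.X - Polynomial.C (x j : ℂ))) :
    ∃ U ∈ unitaryGroup (Fin n) ℂ, X = U * diagonal (fun j => (x j : ℂ)) * star U := by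
  have h1 : ∀ j, ∃ k, x j = hX.eigenvalues k := by
    intro j
    have h0 : (∏ j, (Polynomial.X - Polynomial.C (x j : ℂ))).eval (x j : ℂ) = 0 := by
      rw [Polynomial.eval_prod]
      exact Finset.prod_eq_zero (Finset.mem_univ j) (by simp)
    have h2 := (congrArg (Polynomial.eval (x j : ℂ)) (hX.charpoly_eq.symm.trans hchar)).trans h0
    rw [Polynomial.eval_prod, Finset.prod_eq_zero_iff] at h2
    obtain ⟨k, _, hk⟩ := h2
    refine ⟨k, ?_⟩
    simp only [Polynomial.eval_sub, Polynomial.eval_X, Polynomial.eval_C, sub_eq_zero] at hk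
    exact Complex.ofReal_injective hk
  choose σ hσ using h1
  have hσi : Function.Injective σ := fun i j hij => hx (by rw [hσ, hσ, hij])
  let e : Fin n ≃ Fin n := Equiv.ofBijective σ (Finite.injective_iff_bijective.1 hσi)
  let V : Matrix (Fin n) (Fin n) ℂ := hX.eigenvectorUnitary
  have hV : V ∈ unitaryGroup (Fin n) ℂ := hX.eigenvectorUnitary.2
  have hV1 : star V * V = 1 := (Unitary.mem_iff.1 hV).1
  have hstar : star (V.submatrix id e) = (star V).submatrix e id := rfl
  have hd : diagonal (fun j => (x j : ℂ)) =
      (diagonal fun j => (hX.eigenvalues j : ℂ)).submatrix e e := by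
    rw [submatrix_diagonal_equiv]
    congr 1
    funext j
    rw [hσ]
    rfl
  refine ⟨V.submatrix id e, ?_, ?_⟩
  · rw [mem_unitaryGroup_iff']
    rw [hstar, ← submatrix_mul _ _ e id e Function.bijective_id, hV1, submatrix_one_equiv]
  · have h3 := hX.spectral_theorem
    rw [Unitary.conjStarAlgAut_apply] at h3
    rw [hstar, hd, submatrix_mul_equiv, submatrix_mul_equiv, submatrix_id_id]
    exact h3

/-- The sign `(-1) ^ (n (n - 1) / 2)` relating `∏ i < j, (x j - x i)` to `∏ i < j, (x i - x j)`. -/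
def vandermondeSign (n : ℕ) : ℂ := ∏ i : Fin n, ∏ _j ∈ Finset.Ioi i, (-1)

theorem vandermondeSign_mul_self (n : ℕ) : vandermondeSign n * vandermondeSign n = 1 := by
  simp only [vandermondeSign, ← Finset.prod_mul_distrib]
  simp

theorem prod_sub_eq_vandermondeSign_mul {n : ℕ} (x : Fin n → ℝ) :
    ∏ i, ∏ j ∈ Finset.Ioi i, ((x i : ℂ) - x j) =
      vandermondeSign n * ((vandermonde x).det : ℂ) := by
  rw [det_vandermonde, vandermondeSign]
  push_cast
  simp only [← Finset.prod_mul_distrib]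
  simp

theorem charpoly_conj_diagonal {n : ℕ} {U : Matrix (Fin n) (Fin n) ℂ}
    (hU : U ∈ unitaryGroup (Fin n) ℂ) (X : Matrix (Fin n) (Fin n) ℂ) :
    (U * X * star U).charpoly = X.charpoly := by
  rw [charpoly_mul_comm, ← mul_assoc, (Unitary.mem_iff.1 hU).1, one_mul]

theorem HasDetForm.comp_neg {n : ℕ} {Φ : Matrix (Fin n) (Fin n) ℂ → ℂ}
    {h : Fin n → ℝ → ℂ} {c : ℂ} (H : HasDetForm Φ h c) :
    HasDetForm (fun X => Φ (-X)) (fun i t => h i (-t)) (vandermondeSign n * c) := by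
  intro X hX x hx hchar
  obtain ⟨U, hU, hXU⟩ := exists_unitary_eq_conj_diagonal hX hx hchar
  have h1 := H (-X) hX.neg (fun j => -x j) (neg_injective.comp hx) (by
    rw [hXU, ← neg_mul, ← mul_neg, charpoly_conj_diagonal hU, diagonal_neg, charpoly_diagonal]
    simp)
  have h2 : ((vandermonde fun j => -x j).det : ℂ) = vandermondeSign n * ((vandermonde x).det : ℂ) := by
    rw [← prod_sub_eq_vandermondeSign_mul, det_vandermonde]
    push_cast
    simp [sub_eq_add_neg, add_comm]
  rw [h2] at h1
  linear_combination vandermondeSign n * h1 -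
    Φ (-X) * ((vandermonde x).det : ℂ) * vandermondeSign_mul_self n

theorem continuous_vecMulVec_star {n : ℕ} :
    Continuous fun z : Fin n → ℂ => vecMulVec z (star z) := by
  refine continuous_matrix fun i j => ?_
  simp only [vecMulVec_apply, Pi.star_apply]
  fun_prop

theorem isHermitian_vecMulVec_star {n : ℕ} (z : Fin n → ℂ) : (vecMulVec z (star z)).IsHermitian := by
  rw [IsHermitian, conjTranspose_vecMulVec, star_star]

theorem sum_rankOneWeight {n : ℕ} {x : Fin n → ℝ} (hx : StrictMono x) {y : Fin n → ℝ}
    (hy : y ∈ interlacingBox x) : ∑ j, rankOneWeight x y j = ∑ j, x j - ∑ j, y j := by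
  let w : Fin n → ℂ := fun j => (√(rankOneWeight x y j) : ℂ)
  have hw : ∀ j, ‖w j‖ ^ 2 = rankOneWeight x y j := fun j => by
    simp [w, Real.sq_sqrt (rankOneWeight_pos hx hy j).le]
  have h1 := charpoly_diagonal_sub_vecMulVec x w
  simp only [hw] at h1
  rw [rankOnePoly_rankOneWeight hx.injective] at h1
  have h2 := trace_eq_sum_roots_charpoly (diagonal (fun k => (x k : ℂ)) - vecMulVec w (star w))
  rw [h1, Polynomial.map_prod] at h2
  simp only [Polynomial.map_sub, Polynomial.map_X, Polynomial.map_C] at h2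
  have h3 : (∏ k, (Polynomial.X - Polynomial.C (algebraMap ℝ ℂ (y k)))).roots.sum =
      ((∑ j, y j : ℝ) : ℂ) := by
    have := Polynomial.roots_multiset_prod_X_sub_C
      (Finset.univ.val.map fun k => (algebraMap ℝ ℂ (y k)))
    rw [Multiset.map_map] at this
    exact (congrArg Multiset.sum this).trans (by simp [List.sum_ofFn])
  rw [h3, trace_sub, trace_vecMulVec, trace_diagonal, dotProduct_comm,
    ← sum_sq_norm_eq_re_star_dotProduct, ← Complex.ofReal_sum, ← Complex.ofReal_sub] at h2
  simp only [hw] at h2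
  have := Complex.ofReal_injective h2
  linarith

/-- Convolution of `h` with `t ↦ e^{-γ t}` on the positive half-line. -/
noncomputable def expConv (γ : ℝ) (h : ℝ → ℂ) (x : ℝ) : ℂ :=
  ∫ t in Set.Iic x, Complex.exp (-γ * (x - t)) * h t

theorem integral_interlacingBox_det {n : ℕ} (x : Fin n → ℝ) {g : Fin n → ℝ → ℂ}
    (hg : ∀ i j, IntegrableOn (g i) (Set.Iic (x j))) :
    ∫ y in interlacingBox x, (of fun i j => g i (y j)).det =
      (of fun i j => ∫ t in interlacingInterval x j, g i t).det := by
  have hg' : ∀ i j, IntegrableOn (g i) (interlacingInterval x j) := fun i j =>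
    (hg i j).mono_set fun t ht => ht.1.le
  simp only [det_apply', of_apply]
  rw [interlacingBox, volume_pi, Measure.restrict_pi_pi, integral_finsetSum]
  · refine Finset.sum_congr rfl fun σ _ => ?_
    rw [integral_const_mul]
    congr 1
    exact integral_fintype_prod_eq_prod (fun j t => g (σ j) t)
  · intro σ _
    refine Integrable.const_mul ?_ _
    exact Integrable.fintype_prod (f := fun j t => g (σ j) t) fun j => hg' (σ j) j

theorem det_integral_interlacingInterval {n : ℕ} {x : Fin n → ℝ} (hx : StrictMono x)
    {g : Fin n → ℝ → ℂ} (hg : ∀ i j, IntegrableOn (g i) (Set.Iic (x j))) :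
    (of fun i j => ∫ t in interlacingInterval x j, g i t).det =
      (of fun i j => ∫ t in Set.Iic (x j), g i t).det := by
  cases n with
  | zero => simp
  | succ m =>
    refine (det_eq_of_forall_col_eq_smul_add_pred (fun _ => 1) (fun i => ?_) fun i j => ?_).symm
    · have : interlacingInterval x 0 = Set.Iio (x 0) := by
        ext t
        simp [interlacingInterval]
      rw [of_apply, of_apply, this, integral_Iic_eq_integral_Iio]
    · have h1 : interlacingInterval x j.succ = Set.Ioo (x j.castSucc) (x j.succ) := by
        ext t
        refine ⟨fun ht => ⟨ht.2 _ (Fin.castSucc_lt_succ), ht.1⟩, fun ht => ⟨ht.2, fun k hk => ?_⟩⟩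
        exact lt_of_le_of_lt (hx.monotone (Fin.le_castSucc_iff.2 hk)) ht.1
      rw [of_apply, of_apply, of_apply, h1, one_mul, ← integral_Ioc_eq_integral_Ioo, add_comm,
        ← setIntegral_union (Set.Iic_disjoint_Ioc le_rfl) measurableSet_Ioc (hg _ _)
          ((hg i j.succ).mono_set Set.Ioc_subset_Iic_self),
        Set.Iic_union_Ioc_eq_Iic (hx.monotone (Fin.castSucc_lt_succ).le)]

theorem integrableOn_exp_mul_bounded {γ : ℝ} (hγ : 0 < γ) {h : ℝ → ℂ} (hc : Continuous h) {B : ℝ}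
    (hB : ∀ t, ‖h t‖ ≤ B) (x : ℝ) :
    IntegrableOn (fun t : ℝ => Complex.exp (γ * t) * h t) (Set.Iic x) := by
  refine ((integrableOn_exp_mul_Iic hγ x).mul_const B).mono'
    (Continuous.aestronglyMeasurable (by fun_prop)) (Filter.Eventually.of_forall fun t => ?_)
  rw [norm_mul, Complex.norm_exp]
  simp only [Complex.mul_re, Complex.ofReal_re, Complex.ofReal_im, zero_mul, sub_zero]
  exact mul_le_mul_of_nonneg_left (hB t) (Real.exp_pos _).le

theorem continuous_exp_mul_comp_rankOne {n : ℕ} {Φ : Matrix (Fin n) (Fin n) ℂ → ℂ}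
    (hΦ : Continuous Φ) (γ : ℝ) (X U : Matrix (Fin n) (Fin n) ℂ) :
    Continuous fun r : Fin n → ℝ => Complex.exp (-γ * ∑ i, (r i : ℂ)) *
      Φ (X - vecMulVec (U *ᵥ fun i => (√(r i) : ℂ)) (star (U *ᵥ fun i => (√(r i) : ℂ)))) := by
  have h1 : Continuous fun r : Fin n → ℝ => U *ᵥ fun i => (√(r i) : ℂ) :=
    Continuous.matrix_mulVec continuous_const (by fun_prop)
  exact Continuous.mul (by fun_prop)
    (hΦ.comp (continuous_const.sub (continuous_vecMulVec_star.comp h1)))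

theorem charpoly_conj_diagonal_sub_vecMulVec {n : ℕ} {U : Matrix (Fin n) (Fin n) ℂ}
    (hU : U ∈ unitaryGroup (Fin n) ℂ) (x : Fin n → ℝ) (w : Fin n → ℂ) :
    (U * diagonal (fun j => (x j : ℂ)) * star U -
      vecMulVec (U *ᵥ w) (star (U *ᵥ w))).charpoly =
      (rankOnePoly x fun j => ‖w j‖ ^ 2).map (algebraMap ℝ ℂ) := by
  rw [← charpoly_diagonal_sub_vecMulVec,
    ← charpoly_conj_diagonal hU (diagonal _ - vecMulVec _ _), star_mulVec, mul_sub,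
    sub_mul, mul_vecMulVec, vecMulVec_mul]
  rfl

theorem charpoly_conj_diagonal_sub_vecMulVec_of_rankOneWeight {n : ℕ}
    {U : Matrix (Fin n) (Fin n) ℂ} (hU : U ∈ unitaryGroup (Fin n) ℂ) {x y : Fin n → ℝ}
    (hx : Function.Injective x) {w : Fin n → ℂ} (hw : ∀ j, ‖w j‖ ^ 2 = rankOneWeight x y j) :
    (U * diagonal (fun j => (x j : ℂ)) * star U -
      vecMulVec (U *ᵥ w) (star (U *ᵥ w))).charpoly =
      ∏ j, (Polynomial.X - Polynomial.C (y j : ℂ)) := by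
  rw [charpoly_conj_diagonal_sub_vecMulVec hU]
  simp only [hw]
  change (rankOnePoly x (rankOneWeight x y)).map _ = _
  rw [rankOnePoly_rankOneWeight hx, Polynomial.map_prod]
  simp

theorem ae_forall_ne_zero {n : ℕ} : ∀ᵐ w : Fin n → ℂ, ∀ j, w j ≠ 0 := by
  rw [ae_all_iff]
  intro j
  have h : ∀ᵐ z : ℂ, z ≠ 0 := by simp [ae_iff]
  exact (Measure.quasiMeasurePreserving_eval (fun _ : Fin n => (volume : Measure ℂ)) j).ae h

theorem det_expConv {n : ℕ} (γ : ℝ) (h : Fin n → ℝ → ℂ) (x : Fin n → ℝ) :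
    (of fun i j => expConv γ (h i) (x j)).det =
      Complex.exp (-γ * ∑ j, (x j : ℂ)) *
        (of fun i j => ∫ t in Set.Iic (x j), Complex.exp (γ * t) * h i t).det := by
  rw [Finset.mul_sum, Complex.exp_sum, ← det_mul_row]
  congr 1
  ext i j
  simp only [of_apply, expConv]
  rw [← integral_const_mul]
  congr 1
  funext t
  rw [← mul_assoc, ← Complex.exp_add]
  congr 2
  ring

theorem HasDetForm.rankOne {n : ℕ} {Φ : Matrix (Fin n) (Fin n) ℂ → ℂ}
    {h : Fin n → ℝ → ℂ} {c : ℂ} (H : HasDetForm Φ h c) (hΦ : Continuous Φ)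
    (hh : ∀ i, Continuous (h i)) {B : ℝ} (hB : ∀ i t, ‖h i t‖ ≤ B) {γ : ℝ} (hγ : 0 < γ) :
    HasDetForm (fun X => ∫ z : Fin n → ℂ, Complex.exp (-γ * ((∑ i, ‖z i‖ ^ 2 : ℝ) : ℂ)) *
      Φ (X - vecMulVec z (star z))) (fun i => expConv γ (h i)) (Real.pi ^ n * c) := by
  refine hasDetForm_of_strictMono fun X hX x hx hchar => ?_
  obtain ⟨U, hU, hXU⟩ := exists_unitary_eq_conj_diagonal hX hx.injective hchar
  have hsU : star U * U = 1 := (Unitary.mem_iff.1 hU).1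
  have hΦy : ∀ {y : Fin n → ℝ}, y ∈ interlacingBox x → ∀ {w : Fin n → ℂ},
      (∀ j, ‖w j‖ ^ 2 = rankOneWeight x y j) →
      Φ (X - vecMulVec (U *ᵥ w) (star (U *ᵥ w))) * ((vandermonde y).det : ℂ) =
        c * (of fun i j => h i (y j)).det := by
    intro y hy w hw
    refine H _ (hX.sub (isHermitian_vecMulVec_star _)) y (strictMono_of_mem_interlacingBox hy).injective ?_
    rw [hXU]
    exact charpoly_conj_diagonal_sub_vecMulVec_of_rankOneWeight hU hx.injective hw
  have hV : ∀ {y : Fin n → ℝ}, StrictMono y → ((vandermonde y).det : ℂ) ≠ 0 := fun hy =>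
    Complex.ofReal_ne_zero.2 (det_vandermonde_pos hy).ne'
  let f : (Fin n → ℝ) → ℂ := fun r => Complex.exp (-γ * ∑ i, (r i : ℂ)) *
      Φ (X - vecMulVec (U *ᵥ fun i => (√(r i) : ℂ)) (star (U *ᵥ fun i => (√(r i) : ℂ))))
  have hf : Continuous f := continuous_exp_mul_comp_rankOne hΦ γ X U
  have h1 : ∫ z : Fin n → ℂ, Complex.exp (-γ * ((∑ i, ‖z i‖ ^ 2 : ℝ) : ℂ)) *
      Φ (X - vecMulVec z (star z)) = ∫ z : Fin n → ℂ, f fun i => ‖z i‖ ^ 2 := by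
    rw [← integral_unitary_mulVec hU]
    refine integral_congr_ae ?_
    filter_upwards [ae_forall_ne_zero] with w hw
    have hpos : (fun j => ‖w j‖ ^ 2) ∈ Set.univ.pi fun _ : Fin n => Set.Ioi (0 : ℝ) := fun j _ => by
      have := norm_pos_iff.2 (hw j)
      exact pow_pos this 2
    rw [← rankOneWeight_image_interlacingBox hx] at hpos
    obtain ⟨y, hy, hyw⟩ := hpos
    have h2 := hΦy hy (w := w) fun j => (congrFun hyw j).symm
    have h3 := hΦy hy (w := fun i => (√(‖w i‖ ^ 2) : ℂ)) fun j => by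
      rw [hyw]
      simp
    simp only [f]
    rw [sum_sq_norm_unitary_mulVec hsU, mul_right_cancel₀ (hV (strictMono_of_mem_interlacingBox hy))
      (h2.trans h3.symm)]
    push_cast
    rfl
  have h2 : ∫ y in interlacingBox x, ((vandermonde y).det : ℂ) * f (rankOneWeight x y) =
      ∫ y in interlacingBox x, c * Complex.exp (-γ * ∑ j, (x j : ℂ)) *
        (of fun i j => Complex.exp (γ * y j) * h i (y j)).det := by
    refine setIntegral_congr_fun
      (MeasurableSet.univ_pi fun k => measurableSet_interlacingInterval x k) fun y hy => ?_
    have h3 := hΦy hy (w := fun i => (√(rankOneWeight x y i) : ℂ)) fun j => by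
      simp [Real.sq_sqrt (rankOneWeight_pos hx hy j).le]
    have h4 : (of fun i j => Complex.exp (γ * y j) * h i (y j)).det =
        Complex.exp (γ * ∑ j, (y j : ℂ)) * (of fun i j => h i (y j)).det := by
      rw [Finset.mul_sum, Complex.exp_sum, ← det_mul_row]
      rfl
    have h5 : ∑ j, (rankOneWeight x y j : ℂ) = ∑ j, (x j : ℂ) - ∑ j, (y j : ℂ) := by
      exact_mod_cast sum_rankOneWeight hx hy
    have h6 : Complex.exp (-γ * (∑ j, (x j : ℂ) - ∑ j, (y j : ℂ))) =
        Complex.exp (-γ * ∑ j, (x j : ℂ)) * Complex.exp (γ * ∑ j, (y j : ℂ)) := by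
      rw [← Complex.exp_add]
      congr 1
      ring
    simp only [f]
    rw [h4, h5, h6]
    linear_combination Complex.exp (-γ * ∑ j, (x j : ℂ)) * Complex.exp (γ * ∑ j, (y j : ℂ)) * h3
  have hg : ∀ i j, IntegrableOn (fun t : ℝ => Complex.exp (γ * t) * h i t) (Set.Iic (x j)) :=
    fun i j => integrableOn_exp_mul_bounded hγ (hh i) (hB i) (x j)
  rw [h1, integral_comp_sq_norm hf, integral_pi_Ioi_eq_integral_interlacingBox hx, h2,
    integral_const_mul, integral_interlacingBox_det x hg, det_integral_interlacingInterval hx hg,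
    det_expConv]
  have := hV hx
  field_simp

/-- A linear parametrization of the Hermitian matrices by their real coordinates. -/
noncomputable def hermCoord {n : ℕ} (v : Fin n × Fin n → ℝ) : Matrix (Fin n) (Fin n) ℂ :=
  of fun i j => ((1 + Complex.I) * v (i, j) + (1 - Complex.I) * v (j, i)) / 2

theorem isHermitian_hermCoord {n : ℕ} (v : Fin n × Fin n → ℝ) : (hermCoord v).IsHermitian := by
  ext i j
  simp only [hermCoord, conjTranspose_apply, of_apply, RCLike.star_def, map_div₀, map_add, map_mul,
    map_sub, map_one, Complex.conj_I, Complex.conj_ofReal, map_ofNat]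
  ring

theorem hermCoord_neg {n : ℕ} (v : Fin n × Fin n → ℝ) : hermCoord (-v) = -hermCoord v := by
  ext i j
  simp [hermCoord]
  ring

theorem continuous_hermCoord {n : ℕ} :
    Continuous (hermCoord : (Fin n × Fin n → ℝ) → Matrix (Fin n) (Fin n) ℂ) := by
  refine continuous_matrix fun i j => ?_
  simp only [hermCoord, of_apply]
  fun_prop

theorem Matrix.IsHermitian.re_trace_mul {n : ℕ} {K X : Matrix (Fin n) (Fin n) ℂ}
    (hK : K.IsHermitian) (hX : X.IsHermitian) : ((K * X).trace.re : ℂ) = (K * X).trace := by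
  rw [← Complex.conj_eq_iff_re, starRingEnd_apply, ← trace_conjTranspose, conjTranspose_mul, hK, hX,
    trace_mul_comm]

theorem Matrix.IsHermitian.exists_unitary_conj_diagonal {n : ℕ} {K : Matrix (Fin n) (Fin n) ℂ}
    (hK : K.IsHermitian) : ∃ U ∈ unitaryGroup (Fin n) ℂ, ∃ x : Fin n → ℝ,
      K = U * diagonal (fun j => (x j : ℂ)) * star U := by
  refine ⟨hK.eigenvectorUnitary, hK.eigenvectorUnitary.2, hK.eigenvalues, ?_⟩
  have h3 := hK.spectral_theorem
  rw [Unitary.conjStarAlgAut_apply] at h3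
  exact h3

theorem det_smul_one_sub_smul_conj_diagonal {n : ℕ} {U : Matrix (Fin n) (Fin n) ℂ}
    (hU : U ∈ unitaryGroup (Fin n) ℂ) (d : Fin n → ℂ) (a b : ℂ) :
    (a • (1 : Matrix (Fin n) (Fin n) ℂ) - b • (U * diagonal d * star U)).det =
      ∏ j, (a - b * d j) := by
  have h1 : a • (1 : Matrix (Fin n) (Fin n) ℂ) - b • (U * diagonal d * star U) =
      U * (diagonal fun j => a - b * d j) * star U := by
    have h2 : (diagonal fun j => a - b * d j) = a • (1 : Matrix (Fin n) (Fin n) ℂ) -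
        b • diagonal d := by
      ext i j
      by_cases h : i = j <;> simp [h]
    rw [h2, mul_sub, sub_mul, Matrix.mul_smul, Matrix.smul_mul, mul_one, (Unitary.mem_iff.1 hU).2,
      Matrix.mul_smul, Matrix.smul_mul]
  rw [h1, det_mul_comm, ← mul_assoc, (Unitary.mem_iff.1 hU).1, one_mul, det_diagonal]

theorem norm_sub_I_mul_ge {γ : ℝ} (t : ℝ) : γ ≤ ‖(γ : ℂ) - Complex.I * t‖ := by
  have := Complex.re_le_norm ((γ : ℂ) - Complex.I * t)
  simpa using this

theorem Matrix.IsHermitian.pow_le_norm_det {n : ℕ} {K : Matrix (Fin n) (Fin n) ℂ}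
    (hK : K.IsHermitian) {γ : ℝ} (hγ : 0 < γ) :
    γ ^ n ≤ ‖((γ : ℂ) • (1 : Matrix (Fin n) (Fin n) ℂ) - Complex.I • K).det‖ := by
  obtain ⟨U, hU, x, rfl⟩ := hK.exists_unitary_conj_diagonal
  rw [det_smul_one_sub_smul_conj_diagonal hU, norm_prod]
  calc γ ^ n = ∏ _j : Fin n, γ := by simp
    _ ≤ _ := Finset.prod_le_prod (fun _ _ => hγ.le) fun j _ => norm_sub_I_mul_ge _

theorem integral_cexp_neg_mul_sq_norm_complex {b : ℂ} (hb : 0 < b.re) :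
    ∫ z : ℂ, Complex.exp (-b * (‖z‖ : ℂ) ^ 2) = Real.pi / b := by
  rw [GaussianFourier.integral_cexp_neg_mul_sq_norm hb, Complex.finrank_real_complex]
  simp

theorem integrable_cexp_neg_mul_sq_norm_pi {n : ℕ} {γ : ℝ} (hγ : 0 < γ) :
    Integrable fun z : Fin n → ℂ => Complex.exp (-γ * ((∑ i, ‖z i‖ ^ 2 : ℝ) : ℂ)) := by
  have h1 : Integrable fun z : ℂ => Complex.exp (-γ * (‖z‖ : ℂ) ^ 2) := by
    have := GaussianFourier.integrable_cexp_neg_mul_sq_norm_add (b := (γ : ℂ)) (V := ℂ)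
      (by simpa using hγ) 0 0
    simpa using this
  have h2 := Integrable.fintype_prod (f := fun (_ : Fin n) (z : ℂ) =>
    Complex.exp (-γ * (‖z‖ : ℂ) ^ 2)) (μ := fun _ => volume) fun _ => h1
  refine h2.congr (Filter.Eventually.of_forall fun z => ?_)
  simp only
  rw [← Complex.exp_sum, ← Finset.mul_sum]
  push_cast
  rfl

theorem integral_gaussian_hermitian {n : ℕ} {K : Matrix (Fin n) (Fin n) ℂ}
    (hK : K.IsHermitian) {γ : ℝ} (hγ : 0 < γ) :
    ∫ z : Fin n → ℂ, Complex.exp (-γ * ((∑ i, ‖z i‖ ^ 2 : ℝ) : ℂ)) *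
      Complex.exp (Complex.I * (K * vecMulVec z (star z)).trace) =
      Real.pi ^ n / ((γ : ℂ) • (1 : Matrix (Fin n) (Fin n) ℂ) - Complex.I • K).det := by
  obtain ⟨U, hU, x, rfl⟩ := hK.exists_unitary_conj_diagonal
  have hsU : star U * U = 1 := (Unitary.mem_iff.1 hU).1
  rw [det_smul_one_sub_smul_conj_diagonal hU, ← integral_unitary_mulVec hU]
  have h1 : ∀ z : Fin n → ℂ, Complex.exp (-γ * ((∑ i, ‖(U *ᵥ z) i‖ ^ 2 : ℝ) : ℂ)) *
      Complex.exp (Complex.I * (U * diagonal (fun j => (x j : ℂ)) * star U *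
        vecMulVec (U *ᵥ z) (star (U *ᵥ z))).trace) =
      ∏ j, Complex.exp (-((γ : ℂ) - Complex.I * x j) * (‖z j‖ : ℂ) ^ 2) := by
    intro z
    rw [sum_sq_norm_unitary_mulVec hsU, ← Complex.exp_add, ← Complex.exp_sum, star_mulVec,
      mul_vecMulVec, trace_vecMulVec, mulVec_mulVec, mul_assoc, hsU, mul_one, ← mulVec_mulVec,
      dotProduct_comm, ← dotProduct_mulVec]
    change Complex.exp (_ + Complex.I * (star z ⬝ᵥ (star U *ᵥ (U *ᵥ _)))) = _
    rw [mulVec_mulVec, hsU, one_mulVec, dotProduct]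
    congr 1
    push_cast
    rw [Finset.mul_sum, Finset.mul_sum, ← Finset.sum_add_distrib]
    refine Finset.sum_congr rfl fun j _ => ?_
    rw [mulVec_diagonal, Pi.star_apply, ← Complex.conj_mul']
    simp only [RCLike.star_def]
    ring
  simp only [h1]
  rw [integral_fintype_prod_volume_eq_prod (fun (j : Fin n) (z : ℂ) =>
    Complex.exp (-((γ : ℂ) - Complex.I * x j) * (‖z‖ : ℂ) ^ 2))]
  have h2 : ∀ j, ∫ z : ℂ, Complex.exp (-((γ : ℂ) - Complex.I * x j) * (‖z‖ : ℂ) ^ 2) =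
      Real.pi / ((γ : ℂ) - Complex.I * x j) := fun j =>
    integral_cexp_neg_mul_sq_norm_complex (by simpa using hγ)
  simp only [h2]
  rw [Finset.prod_div_distrib]
  simp

/-- The Fourier transform of a weight on the space of Hermitian matrices. -/
noncomputable def hermFourier {n : ℕ} (W : (Fin n × Fin n → ℝ) → ℂ)
    (X : Matrix (Fin n) (Fin n) ℂ) : ℂ :=
  ∫ v, Complex.exp (-Complex.I * ((hermCoord v * X).trace.re : ℂ)) * W v

/-- The Fourier transform of a weight on the real line. -/
noncomputable def lineFourier (w : ℝ → ℂ) (x : ℝ) : ℂ :=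
  ∫ k : ℝ, Complex.exp (-Complex.I * (k * x : ℝ)) * w k

theorem norm_exp_neg_I_mul (r : ℝ) : ‖Complex.exp (-Complex.I * r)‖ = 1 := by
  rw [show -Complex.I * r = ((-r : ℝ) : ℂ) * Complex.I by push_cast; ring]
  exact Complex.norm_exp_ofReal_mul_I _

theorem continuous_re_trace_hermCoord_mul {n : ℕ} : Continuous
    fun p : (Fin n × Fin n → ℝ) × Matrix (Fin n) (Fin n) ℂ => (hermCoord p.1 * p.2).trace.re :=
  Complex.continuous_re.comp
    (((continuous_hermCoord.comp continuous_fst).matrix_mul continuous_snd).matrix_trace)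

theorem continuous_hermFourier {n : ℕ} {W : (Fin n × Fin n → ℝ) → ℂ} (hW : Integrable W) :
    Continuous (hermFourier W) := by
  have : FirstCountableTopology (Matrix (Fin n) (Fin n) ℂ) :=
    inferInstanceAs (FirstCountableTopology (Fin n → Fin n → ℂ))
  refine continuous_of_dominated (bound := fun v => ‖W v‖) (fun X => ?_)
    (fun X => Filter.Eventually.of_forall fun v => ?_) hW.norm
    (Filter.Eventually.of_forall fun v => ?_)
  · have := continuous_re_trace_hermCoord_mul.comp
      (continuous_id.prodMk continuous_const : Continuous fun v : Fin n × Fin n → ℝ => (v, X))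
    refine AEStronglyMeasurable.mul (Continuous.aestronglyMeasurable ?_) hW.1
    exact Complex.continuous_exp.comp
      (continuous_const.mul (Complex.continuous_ofReal.comp this))
  · rw [norm_mul, norm_exp_neg_I_mul, one_mul]
  · have := continuous_re_trace_hermCoord_mul.comp
      (continuous_const.prodMk continuous_id : Continuous fun X : Matrix (Fin n) (Fin n) ℂ => (v, X))
    exact (Complex.continuous_exp.comp
      (continuous_const.mul (Complex.continuous_ofReal.comp this))).mul continuous_const

theorem norm_lineFourier_le (w : ℝ → ℂ) (x : ℝ) : ‖lineFourier w x‖ ≤ ∫ k, ‖w k‖ := by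
  refine (norm_integral_le_integral_norm _).trans_eq ?_
  simp only [norm_mul, norm_exp_neg_I_mul, one_mul]

theorem continuous_lineFourier {w : ℝ → ℂ} (hw : Integrable w) : Continuous (lineFourier w) := by
  refine continuous_of_dominated (bound := fun v => ‖w v‖) (fun X => ?_)
    (fun X => Filter.Eventually.of_forall fun v => ?_) hw.norm
    (Filter.Eventually.of_forall fun v => ?_)
  · exact AEStronglyMeasurable.mul (Continuous.aestronglyMeasurable (by fun_prop)) hw.1
  · rw [norm_mul, norm_exp_neg_I_mul, one_mul]
  · fun_prop

theorem integral_exp_mul_hermFourier_sub {n : ℕ} {W : (Fin n × Fin n → ℝ) → ℂ}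
    (hW : Integrable W) {γ : ℝ} (hγ : 0 < γ) {X : Matrix (Fin n) (Fin n) ℂ} (hX : X.IsHermitian) :
    ∫ z : Fin n → ℂ, Complex.exp (-γ * ((∑ i, ‖z i‖ ^ 2 : ℝ) : ℂ)) *
      hermFourier W (X - vecMulVec z (star z)) =
      Real.pi ^ n * hermFourier (fun v => W v /
        ((γ : ℂ) • (1 : Matrix (Fin n) (Fin n) ℂ) - Complex.I • hermCoord v).det) X := by
  simp only [hermFourier, ← integral_const_mul]
  rw [integral_integral_swap]
  · refine integral_congr_ae (Filter.Eventually.of_forall fun v => ?_)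
    have hK := isHermitian_hermCoord v
    have h1 : ∀ z : Fin n → ℂ, Complex.exp (-γ * ((∑ i, ‖z i‖ ^ 2 : ℝ) : ℂ)) *
        (Complex.exp (-Complex.I *
          ((hermCoord v * (X - vecMulVec z (star z))).trace.re : ℂ)) * W v) =
        Complex.exp (-Complex.I * ((hermCoord v * X).trace.re : ℂ)) * W v *
        (Complex.exp (-γ * ((∑ i, ‖z i‖ ^ 2 : ℝ) : ℂ)) *
          Complex.exp (Complex.I * (hermCoord v * vecMulVec z (star z)).trace)) := by
      intro z
      rw [hK.re_trace_mul (hX.sub (isHermitian_vecMulVec_star z)), hK.re_trace_mul hX, mul_sub,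
        trace_sub, show ∀ a b : ℂ, -Complex.I * (a - b) = -Complex.I * a + Complex.I * b by
          intro a b; ring, Complex.exp_add]
      ring
    simp only [h1]
    rw [integral_const_mul, integral_gaussian_hermitian hK hγ]
    have h2 : ∀ a b p d : ℂ, a * b * (p / d) = p * (a * (b / d)) := by
      intro a b p d
      ring
    exact h2 _ _ _ _
  · have h2 := (integrable_cexp_neg_mul_sq_norm_pi (n := n) hγ).mul_prod hW
    have h0 : Continuous fun p : (Fin n → ℂ) × (Fin n × Fin n → ℝ) =>
        X - vecMulVec p.1 (star p.1) :=
      continuous_const.sub (continuous_vecMulVec_star.comp continuous_fst)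
    have h3 : Continuous fun p : (Fin n → ℂ) × (Fin n × Fin n → ℝ) =>
        (hermCoord p.2 * (X - vecMulVec p.1 (star p.1))).trace.re := by
      have h5 := continuous_hermCoord.comp
        (continuous_snd : Continuous (Prod.snd : (Fin n → ℂ) × (Fin n × Fin n → ℝ) → _))
      exact Complex.continuous_re.comp (h5.matrix_mul h0).matrix_trace
    have h4 : Continuous fun p : (Fin n → ℂ) × (Fin n × Fin n → ℝ) => Complex.exp (-Complex.I *
        ((hermCoord p.2 * (X - vecMulVec p.1 (star p.1))).trace.re : ℂ)) :=
      Complex.continuous_exp.comp (continuous_const.mul (Complex.continuous_ofReal.comp h3))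
    refine (h2.bdd_mul h4.aestronglyMeasurable (c := 1) (Filter.Eventually.of_forall fun p => ?_)).congr
      (Filter.Eventually.of_forall fun p => ?_)
    · rw [norm_exp_neg_I_mul]
    · simp only [Function.uncurry]
      ring

theorem expConv_lineFourier {w : ℝ → ℂ} (hw : Integrable w) {γ : ℝ} (hγ : 0 < γ) (x : ℝ) :
    expConv γ (lineFourier w) x = lineFourier (fun k => w k / ((γ : ℂ) - Complex.I * k)) x := by
  simp only [expConv, lineFourier, ← integral_const_mul]
  have hexp : ∀ t k : ℝ, Complex.exp (-γ * (x - t)) *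
      (Complex.exp (-Complex.I * (k * t : ℝ)) * w k) =
      Complex.exp (-γ * x) * w k * Complex.exp (((γ : ℂ) - Complex.I * k) * t) := by
    intro t k
    have : Complex.exp (-γ * (x - t)) * Complex.exp (-Complex.I * (k * t : ℝ)) =
        Complex.exp (-γ * x) * Complex.exp (((γ : ℂ) - Complex.I * k) * t) := by
      rw [← Complex.exp_add, ← Complex.exp_add]
      push_cast
      ring_nf
    linear_combination w k * this
  rw [integral_integral_swap]
  · refine integral_congr_ae (Filter.Eventually.of_forall fun k => ?_)
    simp only [hexp]
    rw [integral_const_mul, integral_exp_mul_complex_Iic (by simpa using hγ)]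
    have : Complex.exp (-γ * x) * Complex.exp (((γ : ℂ) - Complex.I * k) * x) =
        Complex.exp (-Complex.I * (k * x : ℝ)) := by
      rw [← Complex.exp_add]
      push_cast
      ring_nf
    rw [← this]
    ring
  · have h1 : IntegrableOn (fun t : ℝ => Complex.exp ((γ : ℂ) * t)) (Set.Iic x) :=
      integrableOn_exp_mul_complex_Iic (by simpa using hγ) x
    have h2 := (h1.mul_prod hw).const_mul (Complex.exp (-γ * x))
    have h3 : Continuous fun p : ℝ × ℝ => Complex.exp (-Complex.I * (p.2 * p.1 : ℝ)) := by fun_prop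
    refine (h2.bdd_mul h3.aestronglyMeasurable (c := 1) (Filter.Eventually.of_forall fun p => ?_)).congr
      (Filter.Eventually.of_forall fun p => ?_)
    · rw [norm_exp_neg_I_mul]
    · simp only [Function.uncurry]
      have : Complex.exp (-γ * (x - p.1)) = Complex.exp (-γ * x) * Complex.exp (γ * p.1) := by
        rw [← Complex.exp_add]
        ring_nf
      rw [this]
      ring

theorem continuous_det_smul_one_sub_hermCoord {n : ℕ} (γ : ℝ) :
    Continuous fun v : Fin n × Fin n → ℝ =>
      ((γ : ℂ) • (1 : Matrix (Fin n) (Fin n) ℂ) - Complex.I • hermCoord v).det :=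
  Continuous.matrix_det (continuous_const.sub (continuous_hermCoord.fun_const_smul Complex.I))

theorem integrable_div_det {n : ℕ} {W : (Fin n × Fin n → ℝ) → ℂ} (hW : Integrable W) {γ : ℝ}
    (hγ : 0 < γ) : Integrable fun v => W v /
      ((γ : ℂ) • (1 : Matrix (Fin n) (Fin n) ℂ) - Complex.I • hermCoord v).det := by
  have h0 : ∀ v : Fin n × Fin n → ℝ,
      γ ^ n ≤ ‖((γ : ℂ) • (1 : Matrix (Fin n) (Fin n) ℂ) - Complex.I • hermCoord v).det‖ :=
    fun v => (isHermitian_hermCoord v).pow_le_norm_det hγ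
  have hc := (continuous_det_smul_one_sub_hermCoord (n := n) γ).fun_inv₀ fun v =>
    norm_pos_iff.1 ((pow_pos hγ n).trans_le (h0 v))
  refine (hW.bdd_mul hc.aestronglyMeasurable (c := (γ ^ n)⁻¹)
    (Filter.Eventually.of_forall fun v => ?_)).congr (Filter.Eventually.of_forall fun v => ?_)
  · rw [norm_inv]
    exact inv_anti₀ (pow_pos hγ n) (h0 v)
  · simp only
    rw [div_eq_inv_mul]

theorem integrable_div_sub_I_mul {w : ℝ → ℂ} (hw : Integrable w) {γ : ℝ} (hγ : 0 < γ) :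
    Integrable fun k : ℝ => w k / ((γ : ℂ) - Complex.I * k) := by
  have h0 : ∀ k : ℝ, γ ≤ ‖(γ : ℂ) - Complex.I * k‖ := norm_sub_I_mul_ge
  have hc : Continuous fun k : ℝ => ((γ : ℂ) - Complex.I * k)⁻¹ :=
    Continuous.inv₀ (by fun_prop) fun v => norm_pos_iff.1 (hγ.trans_le (h0 v))
  refine (hw.bdd_mul hc.aestronglyMeasurable (c := γ⁻¹)
    (Filter.Eventually.of_forall fun v => ?_)).congr (Filter.Eventually.of_forall fun v => ?_)
  · rw [norm_inv]
    exact inv_anti₀ hγ (h0 v)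
  · simp only
    rw [div_eq_inv_mul]

theorem HasDetForm.congr {n : ℕ} {Φ Φ' : Matrix (Fin n) (Fin n) ℂ → ℂ} {h h' : Fin n → ℝ → ℂ}
    {c c' : ℂ} (H : HasDetForm Φ h c) (hΦ : ∀ X, X.IsHermitian → Φ' X = Φ X)
    (hh : ∀ i t, h' i t = h i t) (hc : c' = c) : HasDetForm Φ' h' c' := by
  intro X hX x hx hchar
  rw [hΦ X hX, hc]
  simp only [hh]
  exact H X hX x hx hchar

theorem HasDetForm.div_det {n : ℕ} {W : (Fin n × Fin n → ℝ) → ℂ} {w : Fin n → ℝ → ℂ} {c : ℂ}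
    (H : HasDetForm (hermFourier W) (fun i => lineFourier (w i)) c) (hW : Integrable W)
    (hw : ∀ i, Integrable (w i)) {γ : ℝ} (hγ : 0 < γ) :
    HasDetForm (hermFourier fun v => W v /
      ((γ : ℂ) • (1 : Matrix (Fin n) (Fin n) ℂ) - Complex.I • hermCoord v).det)
      (fun i => lineFourier fun k => w i k / ((γ : ℂ) - Complex.I * k)) c := by
  have h1 := H.rankOne (continuous_hermFourier hW) (fun i => continuous_lineFourier (hw i))
    (B := ∑ i, ∫ k, ‖w i k‖) (fun i t => (norm_lineFourier_le _ _).trans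
      (Finset.single_le_sum (f := fun i => ∫ k, ‖w i k‖)
        (fun i _ => integral_nonneg fun k => norm_nonneg _) (Finset.mem_univ i))) hγ
  intro X hX x hx hchar
  have h2 := h1 X hX x hx hchar
  simp only [integral_exp_mul_hermFourier_sub hW hγ hX, expConv_lineFourier (hw _) hγ] at h2
  have hpi : (Real.pi : ℂ) ^ n ≠ 0 := pow_ne_zero _ (Complex.ofReal_ne_zero.2 Real.pi_ne_zero)
  exact mul_left_cancel₀ hpi (by linear_combination h2)

theorem hermFourier_neg {n : ℕ} (W : (Fin n × Fin n → ℝ) → ℂ) (X : Matrix (Fin n) (Fin n) ℂ) :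
    hermFourier W (-X) = hermFourier (fun v => W (-v)) X := by
  rw [hermFourier, ← integral_neg_eq_self]
  simp only [hermCoord_neg, neg_mul_neg]
  rfl

theorem lineFourier_neg (w : ℝ → ℂ) (x : ℝ) :
    lineFourier w (-x) = lineFourier (fun k => w (-k)) x := by
  rw [lineFourier, ← integral_neg_eq_self]
  simp only [neg_mul_neg]
  rfl

theorem HasDetForm.reflect {n : ℕ} {W : (Fin n × Fin n → ℝ) → ℂ} {w : Fin n → ℝ → ℂ} {c : ℂ}
    (H : HasDetForm (hermFourier W) (fun i => lineFourier (w i)) c) :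
    HasDetForm (hermFourier fun v => W (-v)) (fun i => lineFourier fun k => w i (-k))
      (vandermondeSign n * c) :=
  H.comp_neg.congr (fun X _ => (hermFourier_neg W X).symm) (fun i t => (lineFourier_neg (w i) t).symm) rfl

theorem det_smul_one_sub_mul_det_smul_one_add {n : ℕ} (γ : ℂ) (K : Matrix (Fin n) (Fin n) ℂ) :
    (γ • (1 : Matrix (Fin n) (Fin n) ℂ) - Complex.I • K).det *
      (γ • (1 : Matrix (Fin n) (Fin n) ℂ) - Complex.I • -K).det =
      (γ ^ 2 • (1 : Matrix (Fin n) (Fin n) ℂ) + K ^ 2).det := by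
  rw [← det_mul]
  congr 1
  simp only [sub_mul, mul_sub, Matrix.smul_mul, Matrix.mul_smul, one_mul, mul_one, smul_smul,
    mul_neg, smul_neg, Complex.I_mul_I, neg_smul, one_smul, sq, mul_comm γ Complex.I]
  abel

/-- The density `det(γ² + K²)⁻¹` in the coordinates `hermCoord`. -/
noncomputable def hermDensity {n : ℕ} (γ : ℝ) (v : Fin n × Fin n → ℝ) : ℂ :=
  (((γ : ℂ) ^ 2 • (1 : Matrix (Fin n) (Fin n) ℂ) + hermCoord v ^ 2).det)⁻¹

/-- The density `(γ² + k²)⁻¹`. -/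
noncomputable def lineDensity (γ k : ℝ) : ℂ := ((γ : ℂ) ^ 2 + (k : ℂ) ^ 2)⁻¹

theorem HasDetForm.mul_density {n : ℕ} {W : (Fin n × Fin n → ℝ) → ℂ} {w : Fin n → ℝ → ℂ} {c : ℂ}
    (H : HasDetForm (hermFourier W) (fun i => lineFourier (w i)) c) (hW : Integrable W)
    (hw : ∀ i, Integrable (w i)) {γ : ℝ} (hγ : 0 < γ) :
    HasDetForm (hermFourier fun v => W v * hermDensity γ v)
      (fun i => lineFourier fun k => w i k * lineDensity γ k) c ∧
      Integrable (fun v => W v * hermDensity γ v) ∧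
      ∀ i, Integrable fun k => w i k * lineDensity γ k := by
  have hW' := integrable_div_det hW hγ
  have hw' := fun i => integrable_div_sub_I_mul (hw i) hγ
  have h1 : (fun v => W v * hermDensity γ v) = fun v => (fun v => W (-v) / ((γ : ℂ) • 1 -
      Complex.I • hermCoord (-v)).det / ((γ : ℂ) • 1 - Complex.I • hermCoord v).det) (-v) := by
    funext v
    simp only [neg_neg]
    rw [hermDensity, ← det_smul_one_sub_mul_det_smul_one_add, hermCoord_neg, mul_inv, div_div,
      div_eq_mul_inv, mul_inv]
  have h2 : ∀ i, (fun k => w i k * lineDensity γ k) = fun k => (fun k : ℝ => w i (-k) /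
      ((γ : ℂ) - Complex.I * ((-k : ℝ) : ℂ)) / ((γ : ℂ) - Complex.I * k)) (-k) := by
    intro i
    funext k
    simp only [neg_neg]
    rw [lineDensity, div_div, div_eq_mul_inv]
    congr 2
    push_cast
    linear_combination (k : ℂ) ^ 2 * Complex.I_sq
  simp only [h1, h2]
  refine ⟨?_, (integrable_div_det hW'.comp_neg hγ).comp_neg, fun i =>
    (integrable_div_sub_I_mul (hw' i).comp_neg hγ).comp_neg⟩
  have h3 := ((H.div_det hW hw hγ).reflect.div_det hW'.comp_neg (fun i => (hw' i).comp_neg) hγ).reflect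
  exact h3.congr (fun _ _ => rfl) (fun _ _ => rfl) (by
    linear_combination (-c) * vandermondeSign_mul_self n)

theorem HasDetForm.mul_density_pow {n : ℕ} {W : (Fin n × Fin n → ℝ) → ℂ} {w : Fin n → ℝ → ℂ}
    {c : ℂ} (H : HasDetForm (hermFourier W) (fun i => lineFourier (w i)) c) (hW : Integrable W)
    (hw : ∀ i, Integrable (w i)) {γ : ℝ} (hγ : 0 < γ) (m : ℕ) :
    HasDetForm (hermFourier fun v => W v * hermDensity γ v ^ m)
      (fun i => lineFourier fun k => w i k * lineDensity γ k ^ m) c ∧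
      Integrable (fun v => W v * hermDensity γ v ^ m) ∧
      ∀ i, Integrable fun k => w i k * lineDensity γ k ^ m := by
  induction m with
  | zero => simpa using ⟨H, hW, hw⟩
  | succ m ih =>
    simp only [pow_succ, ← mul_assoc]
    exact ih.1.mul_density ih.2.1 ih.2.2 hγ

theorem hasDerivAt_lineFourier {w : ℝ → ℂ} (hw : Integrable w)
    (hw' : Integrable fun k : ℝ => -Complex.I * k * w k) (x : ℝ) :
    HasDerivAt (lineFourier w) (lineFourier (fun k : ℝ => -Complex.I * k * w k) x) x := by
  refine (hasDerivAt_integral_of_dominated_loc_of_deriv_le (Filter.univ_mem)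
    (F' := fun (x : ℝ) (k : ℝ) => Complex.exp (-Complex.I * (k * x : ℝ)) * (-Complex.I * k * w k))
    (bound := fun k : ℝ => ‖-Complex.I * k * w k‖)
    (Filter.Eventually.of_forall fun y => ?_) ?_ ?_
    (Filter.Eventually.of_forall fun k y _ => ?_) hw'.norm
    (Filter.Eventually.of_forall fun k y _ => ?_)).2
  · exact AEStronglyMeasurable.mul (Continuous.aestronglyMeasurable (by fun_prop)) hw.1
  · exact hw.bdd_mul (Continuous.aestronglyMeasurable (by fun_prop)) (c := 1)
      (Filter.Eventually.of_forall fun k => (norm_exp_neg_I_mul _).le)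
  · exact AEStronglyMeasurable.mul (Continuous.aestronglyMeasurable (by fun_prop)) hw'.1
  · rw [norm_mul, norm_exp_neg_I_mul, one_mul]
  · have h1 : HasDerivAt (fun y : ℝ => (-Complex.I * (k * y : ℝ) : ℂ)) (-Complex.I * k) y := by
      have := ((hasDerivAt_id y).const_mul k).ofReal_comp.const_mul (-Complex.I)
      simpa using this
    exact (h1.cexp.mul_const (w k)).congr_deriv (mul_assoc _ _ _)

/-- The polynomials `Q` with `Q e^{-x²/4b}` proportional to the derivatives of `e^{-x²/4b}`. -/
noncomputable def gaussPoly (b : ℂ) : ℕ → Polynomial ℂ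
  | 0 => 1
  | i + 1 => Polynomial.X * gaussPoly b i -
      Polynomial.C (2 * b) * Polynomial.derivative (gaussPoly b i)

theorem monic_gaussPoly (b : ℂ) (i : ℕ) :
    (gaussPoly b i).natDegree = i ∧ (gaussPoly b i).Monic := by
  induction i with
  | zero => simp [gaussPoly]
  | succ i ih =>
    have h1 : (Polynomial.X * gaussPoly b i).Monic := Polynomial.monic_X.mul ih.2
    have h2 : (Polynomial.X * gaussPoly b i).natDegree = i + 1 := by
      rw [Polynomial.natDegree_X_mul ih.2.ne_zero, ih.1]
    have h3 : (Polynomial.C (2 * b) * Polynomial.derivative (gaussPoly b i)).natDegree <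
        (Polynomial.X * gaussPoly b i).natDegree := by
      refine (Polynomial.natDegree_C_mul_le _ _).trans_lt ?_
      have := Polynomial.natDegree_derivative_le (gaussPoly b i)
      omega
    refine ⟨?_, h1.sub_of_left (Polynomial.degree_lt_degree h3)⟩
    rw [gaussPoly, Polynomial.natDegree_sub_eq_left_of_natDegree_lt h3, h2]

/-- The weight `(-ik)^i e^{-b k²}`. -/
noncomputable def lineGaussian (b : ℝ) (i : ℕ) (k : ℝ) : ℂ :=
  (-Complex.I * k) ^ i * Complex.exp (-b * (k : ℂ) ^ 2)

theorem integrable_lineGaussian {b : ℝ} (hb : 0 < b) (i : ℕ) : Integrable (lineGaussian b i) := by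
  have h1 := (integrable_rpow_mul_exp_neg_mul_sq hb (s := (i : ℝ))
    (by linarith [(Nat.cast_nonneg i : (0 : ℝ) ≤ i)])).ofReal (𝕜 := ℂ)
  refine (h1.const_mul ((-Complex.I) ^ i)).congr (Filter.Eventually.of_forall fun k => ?_)
  simp only [lineGaussian, Real.rpow_natCast, mul_pow]
  push_cast
  rw [mul_assoc]
  congr 2
  exact (Complex.ofReal_exp _).trans (by push_cast; rfl)

theorem lineFourier_lineGaussian {b : ℝ} (hb : 0 < b) (i : ℕ) (x : ℝ) :
    lineFourier (lineGaussian b i) x = (Real.pi / b : ℂ) ^ (1 / 2 : ℂ) * (-(2 * b : ℂ)⁻¹) ^ i *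
      (Complex.exp (-(x : ℂ) ^ 2 / (4 * b)) * (gaussPoly b i).eval (x : ℂ)) := by
  induction i generalizing x with
  | zero =>
    have := fourierIntegral_gaussian (b := (b : ℂ)) (by simpa using hb) (-x)
    simp only [gaussPoly, Polynomial.eval_one, mul_one, pow_zero]
    rw [neg_sq] at this
    rw [← this]
    refine integral_congr_ae (Filter.Eventually.of_forall fun k => ?_)
    simp only [lineGaussian, pow_zero, one_mul]
    congr 2
    push_cast
    ring
  | succ i ih =>
    have hsucc : lineGaussian b (i + 1) = fun k : ℝ => -Complex.I * k * lineGaussian b i k := by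
      funext k
      rw [lineGaussian, lineGaussian, pow_succ]
      ring
    have h1 := hasDerivAt_lineFourier (integrable_lineGaussian hb i)
      (hsucc ▸ integrable_lineGaussian hb (i + 1)) x
    rw [← hsucc, funext ih] at h1
    have h2 : HasDerivAt (fun y : ℂ => Complex.exp (-y ^ 2 / (4 * b)))
        (Complex.exp (-(x : ℂ) ^ 2 / (4 * b)) * (-(2 * x) / (4 * b))) (x : ℂ) := by
      have := ((((hasDerivAt_id (x : ℂ)).pow 2).neg).div_const (4 * (b : ℂ))).cexp
      simpa using this
    have h3 := ((h2.mul ((gaussPoly b i).hasDerivAt (x : ℂ))).const_mul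
      ((Real.pi / b : ℂ) ^ (1 / 2 : ℂ) * (-(2 * b : ℂ)⁻¹) ^ i)).comp_ofReal
    rw [h1.unique h3, gaussPoly, pow_succ]
    have hb' : (b : ℂ) ≠ 0 := Complex.ofReal_ne_zero.2 hb.ne'
    have h4 : -(2 * (x : ℂ)) / (4 * b) = -(2 * b : ℂ)⁻¹ * x := by
      field_simp
      ring
    have h5 : (2 * b : ℂ)⁻¹ * (2 * b) = 1 := inv_mul_cancel₀ (by simpa using hb')
    simp only [Polynomial.eval_sub, Polynomial.eval_mul, Polynomial.eval_X, Polynomial.eval_C]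
    rw [h4]
    have h6 : ∀ A p E q t Q Q' y : ℂ, q * t = 1 →
        A * p * (E * (-q * y) * Q + E * Q') = A * (p * -q) * (E * (y * Q - t * Q')) := by
      intro A p E q t Q Q' y hq
      linear_combination (-(A * p * E * Q')) * hq
    exact h6 _ _ _ _ _ _ _ _ h5

/-- The weight `e^{-b ∑ v²}` in the coordinates `hermCoord`. -/
noncomputable def hermGaussian {n : ℕ} (b : ℝ) (v : Fin n × Fin n → ℝ) : ℂ :=
  Complex.exp (-b * ∑ p, (v p : ℂ) ^ 2)

theorem integrable_hermGaussian {n : ℕ} {b : ℝ} (hb : 0 < b) :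
    Integrable (hermGaussian b : (Fin n × Fin n → ℝ) → ℂ) := by
  have := GaussianFourier.integrable_cexp_neg_mul_sum_add (b := (b : ℂ)) (ι := Fin n × Fin n)
    (by simpa using hb) 0
  exact this.congr (Filter.Eventually.of_forall fun v => by simp [hermGaussian])

theorem trace_hermCoord_mul {n : ℕ} (v : Fin n × Fin n → ℝ) (X : Matrix (Fin n) (Fin n) ℂ) :
    (hermCoord v * X).trace =
      ∑ p, ((1 + Complex.I) * X p.2 p.1 + (1 - Complex.I) * X p.1 p.2) / 2 * v p := by
  rw [Fintype.sum_prod_type]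
  have h1 : ∀ i j, ((1 + Complex.I) * X j i + (1 - Complex.I) * X i j) / 2 * (v (i, j) : ℂ) =
      (1 + Complex.I) / 2 * (v (i, j) * X j i) + (1 - Complex.I) / 2 * (v (i, j) * X i j) := by
    intro i j
    ring
  have h2 : ∀ i j, hermCoord v i j * X j i =
      (1 + Complex.I) / 2 * (v (i, j) * X j i) + (1 - Complex.I) / 2 * (v (j, i) * X j i) := by
    intro i j
    simp only [hermCoord, of_apply]
    ring
  simp only [trace, diag_apply, mul_apply, h1, h2, Finset.sum_add_distrib]
  congr 1
  exact Finset.sum_comm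

theorem sum_sq_hermCoord_dual {n : ℕ} (X : Matrix (Fin n) (Fin n) ℂ) :
    ∑ p : Fin n × Fin n, (((1 + Complex.I) * X p.2 p.1 + (1 - Complex.I) * X p.1 p.2) / 2) ^ 2 =
      (X * X).trace := by
  rw [Fintype.sum_prod_type]
  have h1 : ∀ i j, (((1 + Complex.I) * X j i + (1 - Complex.I) * X i j) / 2) ^ 2 =
      X i j * X j i + (Complex.I / 2 * X j i ^ 2 - Complex.I / 2 * X i j ^ 2) := by
    intro i j
    linear_combination (X j i ^ 2 / 4 + X i j ^ 2 / 4 - X i j * X j i / 2) * Complex.I_sq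
  simp only [h1, Finset.sum_add_distrib, Finset.sum_sub_distrib, trace, diag_apply, mul_apply]
  rw [Finset.sum_comm (f := fun i j => Complex.I / 2 * X j i ^ 2), sub_self, add_zero]

theorem hermFourier_hermGaussian {n : ℕ} {b : ℝ} (hb : 0 < b) {X : Matrix (Fin n) (Fin n) ℂ}
    (hX : X.IsHermitian) : hermFourier (hermGaussian b) X =
      ((Real.pi / b : ℂ) ^ (1 / 2 : ℂ)) ^ (n * n) * Complex.exp (-(X * X).trace / (4 * b)) := by
  have h1 := GaussianFourier.integral_cexp_neg_mul_sum_add (b := (b : ℂ)) (ι := Fin n × Fin n)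
    (by simpa using hb) fun p => -Complex.I *
      (((1 + Complex.I) * X p.2 p.1 + (1 - Complex.I) * X p.1 p.2) / 2)
  simp only [mul_pow, ← Finset.mul_sum, sum_sq_hermCoord_dual, mul_assoc (-Complex.I),
    ← trace_hermCoord_mul] at h1
  have h2 : hermFourier (hermGaussian b) X = ∫ v : Fin n × Fin n → ℝ,
      Complex.exp (-b * ∑ p, (v p : ℂ) ^ 2 + -Complex.I * (hermCoord v * X).trace) := by
    refine integral_congr_ae (Filter.Eventually.of_forall fun v => ?_)
    simp only
    rw [hermGaussian, (isHermitian_hermCoord v).re_trace_mul hX, add_comm, Complex.exp_add]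
  rw [h2, h1, ← Complex.cpow_nat_mul, neg_sq, Complex.I_sq, neg_one_mul, Fintype.card_prod,
    Fintype.card_fin, mul_one_div]

theorem det_gaussPoly {n : ℕ} (b : ℝ) (x : Fin n → ℝ) :
    (of fun i j : Fin n => (gaussPoly b i).eval (x j : ℂ)).det = ((vandermonde x).det : ℂ) := by
  have h := det_eval_matrixOfPolynomials_eq_det_vandermonde (fun j => (x j : ℂ))
    (fun i : Fin n => gaussPoly b i) (fun i => (monic_gaussPoly b i).1)
    fun i => (monic_gaussPoly b i).2
  rw [← det_transpose]
  refine h.symm.trans ?_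
  simp [det_vandermonde]

theorem prod_sq_pow_eq (a : ℂ) (n : ℕ) : a ^ n * ∏ i : Fin n, (a ^ 2) ^ (i : ℕ) = a ^ (n * n) := by
  rw [Finset.prod_pow_eq_pow_sum, Fin.sum_univ_eq_sum_range fun i => i, ← pow_mul, ← pow_add,
    mul_comm 2, Finset.sum_range_id_mul_two]
  congr 1
  cases n with
  | zero => rfl
  | succ n => simp; ring

theorem trace_mul_self_eq_sum {n : ℕ} {X : Matrix (Fin n) (Fin n) ℂ}
    (hX : X.IsHermitian) {x : Fin n → ℝ} (hx : Function.Injective x)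
    (hchar : X.charpoly = ∏ j, (Polynomial.X - Polynomial.C (x j : ℂ))) :
    (X * X).trace = ∑ j, (x j : ℂ) ^ 2 := by
  obtain ⟨U, hU, rfl⟩ := exists_unitary_eq_conj_diagonal hX hx hchar
  have hsU : star U * U = 1 := (Unitary.mem_iff.1 hU).1
  have h1 : U * diagonal (fun j => (x j : ℂ)) * star U *
      (U * diagonal (fun j => (x j : ℂ)) * star U) =
      U * (diagonal fun j => (x j : ℂ) ^ 2) * star U := by
    calc _ = U * diagonal (fun j => (x j : ℂ)) * (star U * U) *
          (diagonal (fun j => (x j : ℂ)) * star U) := by simp only [mul_assoc]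
      _ = _ := by
        rw [hsU, mul_one, mul_assoc, ← mul_assoc (diagonal _), diagonal_mul_diagonal, mul_assoc]
        simp only [sq]
  rw [h1, trace_mul_comm, ← mul_assoc, hsU, one_mul, trace_diagonal]

theorem hasDetForm_gaussian {n : ℕ} {b : ℝ} (hb : 0 < b) :
    HasDetForm (n := n) (hermFourier (hermGaussian b))
      (fun i => lineFourier (lineGaussian b i)) (∏ i : Fin n, (-(2 * Real.pi : ℂ)) ^ (i : ℕ)) := by
  intro X hX x hx hchar
  have hb' : (b : ℂ) ≠ 0 := Complex.ofReal_ne_zero.2 hb.ne'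
  set a : ℂ := (Real.pi / b : ℂ) ^ (1 / 2 : ℂ) with ha
  have ha2 : a ^ 2 = Real.pi / b := by
    simp [ha]
  have h1 : (of fun i j : Fin n => lineFourier (lineGaussian b i) (x j)).det =
      (∏ i : Fin n, (a * (-(2 * b : ℂ)⁻¹) ^ (i : ℕ))) *
        ((∏ j, Complex.exp (-(x j : ℂ) ^ 2 / (4 * b))) * ((vandermonde x).det : ℂ)) := by
    rw [← det_gaussPoly b, ← det_mul_row, ← det_mul_column]
    simp only [lineFourier_lineGaussian hb]
    rfl
  have h2 : ∏ j, Complex.exp (-(x j : ℂ) ^ 2 / (4 * b)) =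
      Complex.exp (-(X * X).trace / (4 * b)) := by
    rw [← Complex.exp_sum, trace_mul_self_eq_sum hX hx hchar, ← Finset.sum_div,
      ← Finset.sum_neg_distrib]
  have h3 : (∏ i : Fin n, (-(2 * Real.pi : ℂ)) ^ (i : ℕ)) *
      (∏ i : Fin n, (a * (-(2 * b : ℂ)⁻¹) ^ (i : ℕ))) = a ^ (n * n) := by
    rw [← prod_sq_pow_eq, Finset.prod_mul_distrib, Finset.prod_const, Finset.card_univ,
      Fintype.card_fin, mul_left_comm, ← Finset.prod_mul_distrib]
    simp only [← mul_pow, ha2]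
    congr 3
    funext i
    congr 1
    field_simp
  rw [h1, h2, hermFourier_hermGaussian hb hX, ← ha, ← h3]
  ring

theorem norm_exp_neg_I_mul_sub_one_le (r : ℝ) : ‖Complex.exp (-Complex.I * r) - 1‖ ≤ |r| := by
  have := Real.norm_exp_I_mul_ofReal_sub_one_le (x := -r)
  rw [norm_neg, Real.norm_eq_abs] at this
  refine le_trans (le_of_eq ?_) this
  congr 3
  push_cast
  ring

theorem norm_det_lineFourier_le {n : ℕ} {w : Fin n → ℝ → ℂ} (hw : ∀ i, Integrable (w i))
    {g : ℝ → ℝ} (hg : Integrable g) (hle : ∀ i, ∀ m < n, ∀ k, |k| ^ m * ‖w i k‖ ≤ g k)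
    {t : ℝ} (ht : 0 < t) :
    ‖(of fun i j : Fin n => lineFourier (w i) (t * (j : ℕ))).det‖ ≤
      (∏ m : Fin n, t ^ (m : ℕ)) * (n.factorial * (∫ k, g k) ^ n) := by
  let a : Fin n → ℕ → ℂ := fun i m =>
    ∫ k : ℝ, (Complex.exp (-Complex.I * (k * t : ℝ)) - 1) ^ m * w i k
  have hint : ∀ i m, Integrable fun k : ℝ =>
      (Complex.exp (-Complex.I * (k * t : ℝ)) - 1) ^ m * w i k := by
    intro i m
    refine (hw i).bdd_mul (Continuous.aestronglyMeasurable (by fun_prop)) (c := 2 ^ m)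
      (Filter.Eventually.of_forall fun k => ?_)
    rw [norm_pow]
    refine pow_le_pow_left₀ (norm_nonneg _) ((norm_sub_le _ _).trans ?_) m
    rw [norm_exp_neg_I_mul, norm_one]
    norm_num
  have ha : ∀ i, ∀ m < n, ‖a i m / (t : ℂ) ^ m‖ ≤ ∫ k, g k := by
    intro i m hm
    rw [norm_div, norm_pow, Complex.norm_of_nonneg ht.le, div_le_iff₀ (pow_pos ht m), mul_comm,
      ← integral_const_mul]
    refine norm_integral_le_of_norm_le (hg.const_mul _) (Filter.Eventually.of_forall fun k => ?_)
    rw [norm_mul, norm_pow]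
    calc _ ≤ |k * t| ^ m * ‖w i k‖ := by
          gcongr
          exact norm_exp_neg_I_mul_sub_one_le _
      _ = t ^ m * (|k| ^ m * ‖w i k‖) := by
          rw [abs_mul, abs_of_pos ht]
          ring
      _ ≤ t ^ m * g k := by
          gcongr
          exact hle i m hm k
  have hL : ∀ i (j : Fin n), lineFourier (w i) (t * (j : ℕ)) =
      ∑ m : Fin n, a i m * ((j : ℕ).choose m : ℂ) := by
    intro i j
    have h1 : ∀ k : ℝ, Complex.exp (-Complex.I * (k * (t * (j : ℕ)) : ℝ)) * w i k =
        ∑ m : Fin n, (Complex.exp (-Complex.I * (k * t : ℝ)) - 1) ^ (m : ℕ) * w i k *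
          ((j : ℕ).choose m : ℂ) := by
      intro k
      have h2 : Complex.exp (-Complex.I * (k * (t * (j : ℕ)) : ℝ)) =
          ((Complex.exp (-Complex.I * (k * t : ℝ)) - 1) + 1) ^ (j : ℕ) := by
        rw [sub_add_cancel, ← Complex.exp_nat_mul]
        congr 1
        push_cast
        ring
      rw [h2, add_pow, Fin.sum_univ_eq_sum_range (fun m =>
        (Complex.exp (-Complex.I * (k * t : ℝ)) - 1) ^ m * w i k * ((j : ℕ).choose m : ℂ)),
        Finset.sum_mul]
      refine Finset.sum_subset_zero_on_sdiff
        (Finset.range_mono j.2) (fun m hm => ?_) fun m _ => ?_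
      · rw [Finset.mem_sdiff, Finset.mem_range, Finset.mem_range] at hm
        rw [Nat.choose_eq_zero_of_lt (by omega)]
        simp
      · rw [one_pow]
        ring
    rw [lineFourier, integral_congr_ae (Filter.Eventually.of_forall h1),
      integral_finsetSum _ fun (m : Fin n) _ => (hint i m).mul_const ((j : ℕ).choose m : ℂ)]
    exact Finset.sum_congr rfl fun m _ => integral_mul_const _ _
  have hB : (of fun m j : Fin n => ((j : ℕ).choose m : ℂ)).det = 1 := by
    rw [det_of_isUpperTriangular]
    · simp
    · intro i j hij
      simp only [id, of_apply] at hij ⊢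
      rw [Nat.choose_eq_zero_of_lt hij, Nat.cast_zero]
  have hAB : (of fun i j : Fin n => lineFourier (w i) (t * (j : ℕ))) =
      (of fun i m : Fin n => (t : ℂ) ^ (m : ℕ) * (of fun i m : Fin n => a i m / (t : ℂ) ^ (m : ℕ)) i m) *
        of fun m j : Fin n => ((j : ℕ).choose m : ℂ) := by
    ext i j
    rw [of_apply, hL, mul_apply]
    refine Finset.sum_congr rfl fun m _ => ?_
    simp only [of_apply]
    rw [mul_div_cancel₀ _ (pow_ne_zero _ (Complex.ofReal_ne_zero.2 ht.ne'))]
  rw [hAB, det_mul, hB, mul_one, det_mul_row, norm_mul, norm_prod]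
  have h3 := Matrix.det_le (abv := NormedField.toAbsoluteValue ℂ) (x := ∫ k, g k)
    (A := of fun i m : Fin n => a i m / (t : ℂ) ^ (m : ℕ)) fun i m => ha i m m.2
  rw [Fintype.card_fin, nsmul_eq_mul] at h3
  refine mul_le_mul (le_of_eq ?_) h3 (norm_nonneg _) (Finset.prod_nonneg fun m _ => by positivity)
  refine Finset.prod_congr rfl fun m _ => ?_
  rw [norm_pow, Complex.norm_of_nonneg ht.le]

theorem HasDetForm.norm_zero_le {n : ℕ} {Φ : Matrix (Fin n) (Fin n) ℂ → ℂ} {w : Fin n → ℝ → ℂ}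
    {c : ℂ} (H : HasDetForm Φ (fun i => lineFourier (w i)) c) (hΦ : Continuous Φ)
    (hw : ∀ i, Integrable (w i)) {g : ℝ → ℝ} (hg : Integrable g)
    (hle : ∀ i, ∀ m < n, ∀ k, |k| ^ m * ‖w i k‖ ≤ g k) :
    ‖Φ 0‖ ≤ ‖c‖ * (n.factorial * (∫ k, g k) ^ n) /
      (vandermonde fun j : Fin n => ((j : ℕ) : ℝ)).det := by
  have hmono : StrictMono fun j : Fin n => ((j : ℕ) : ℝ) := fun i j hij => Nat.cast_lt.2 hij
  have hV := det_vandermonde_pos hmono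
  have hbound : ∀ t : ℝ, 0 < t →
      ‖Φ (diagonal fun j : Fin n => ((t * (j : ℕ) : ℝ) : ℂ))‖ ≤
        ‖c‖ * (n.factorial * (∫ k, g k) ^ n) /
          (vandermonde fun j : Fin n => ((j : ℕ) : ℝ)).det := by
    intro t ht
    have h1 := H (diagonal fun j : Fin n => ((t * (j : ℕ) : ℝ) : ℂ))
      (isHermitian_diagonal_iff.2 fun j => Complex.conj_ofReal _)
      (fun j => t * (j : ℕ)) (fun i j hij => hmono.injective (mul_left_cancel₀ ht.ne' hij))
      (charpoly_diagonal _)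
    have h2 : (vandermonde fun j : Fin n => t * (j : ℕ)).det =
        (∏ m : Fin n, t ^ (m : ℕ)) * (vandermonde fun j : Fin n => ((j : ℕ) : ℝ)).det := by
      rw [← det_mul_row]
      congr 1
      ext i j
      rw [vandermonde_apply, of_apply, vandermonde_apply, mul_pow]
    have hp : 0 < ∏ m : Fin n, t ^ (m : ℕ) := Finset.prod_pos fun m _ => pow_pos ht _
    have h3 := congrArg norm h1
    rw [norm_mul, norm_mul, h2, Complex.norm_of_nonneg (mul_pos hp hV).le] at h3
    have h4 := mul_le_mul_of_nonneg_left (norm_det_lineFourier_le hw hg hle ht) (norm_nonneg c)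
    rw [← h3] at h4
    rw [le_div_iff₀ hV]
    refine le_of_mul_le_mul_left ?_ hp
    linarith
  have hc : Continuous fun t : ℝ => ‖Φ (diagonal fun j : Fin n => ((t * (j : ℕ) : ℝ) : ℂ))‖ :=
    (hΦ.comp (Continuous.matrix_diagonal (by fun_prop))).norm
  have hlim := (hc.tendsto 0).mono_left (nhdsWithin_le_nhds (s := Set.Ioi 0))
  refine le_of_tendsto (by simpa using hlim) ?_
  filter_upwards [self_mem_nhdsWithin] with t ht using by simpa using hbound t ht

theorem exists_nonneg_hermDensity_eq {n : ℕ} (γ : ℝ) (v : Fin n × Fin n → ℝ) :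
    ∃ r : ℝ, 0 ≤ r ∧ hermDensity γ v = r := by
  obtain ⟨U, hU, x, hx⟩ := (isHermitian_hermCoord v).exists_unitary_conj_diagonal
  refine ⟨(∏ j, (γ ^ 2 + x j ^ 2))⁻¹, by positivity, ?_⟩
  rw [hermDensity, ← det_smul_one_sub_mul_det_smul_one_add, smul_neg, ← neg_smul, hx,
    det_smul_one_sub_smul_conj_diagonal hU, det_smul_one_sub_smul_conj_diagonal hU,
    ← Finset.prod_mul_distrib]
  push_cast
  congr 1
  refine Finset.prod_congr rfl fun j _ => ?_
  linear_combination -(x j : ℂ) ^ 2 * Complex.I_sq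

theorem lineDensity_eq_ofReal (γ k : ℝ) : lineDensity γ k = ((γ ^ 2 + k ^ 2)⁻¹ : ℝ) := by
  rw [lineDensity]
  push_cast
  rfl

theorem continuous_lineDensity {γ : ℝ} (hγ : 0 < γ) : Continuous (lineDensity γ) := by
  simp only [funext (lineDensity_eq_ofReal γ)]
  refine Complex.continuous_ofReal.comp (Continuous.inv₀ (by fun_prop) fun k => ?_)
  positivity

theorem integrable_inv_sq_add_sq {γ : ℝ} (hγ : 0 < γ) :
    Integrable fun k : ℝ => (γ ^ 2 + k ^ 2)⁻¹ := by
  refine ((integrable_inv_one_add_sq.comp_div hγ.ne').const_mul (γ ^ 2)⁻¹).congr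
    (Filter.Eventually.of_forall fun k => ?_)
  simp only
  rw [← mul_inv]
  congr 1
  field_simp

theorem abs_pow_mul_inv_le {γ : ℝ} (hγ : 0 < γ) {j m : ℕ} (hj : j ≤ 2 * m) (k : ℝ) :
    |k| ^ j * ((γ ^ 2 + k ^ 2)⁻¹) ^ (m + 1) ≤
      (((γ ^ 2) ^ m)⁻¹ + 1) * (γ ^ 2 + k ^ 2)⁻¹ := by
  have hu : 0 < γ ^ 2 + k ^ 2 := by positivity
  have h1 : |k| ^ j ≤ 1 + (γ ^ 2 + k ^ 2) ^ m := by
    rcases le_total |k| 1 with h | h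
    · have := pow_le_one₀ (n := j) (abs_nonneg k) h
      have := pow_pos hu m
      linarith
    · calc |k| ^ j ≤ |k| ^ (2 * m) := pow_le_pow_right₀ h hj
        _ = (k ^ 2) ^ m := by rw [pow_mul, sq_abs]
        _ ≤ (γ ^ 2 + k ^ 2) ^ m := by
          gcongr
          linarith [sq_nonneg γ]
        _ ≤ _ := by linarith
  have h2 : ((γ ^ 2 + k ^ 2) ^ m)⁻¹ ≤ ((γ ^ 2) ^ m)⁻¹ := by
    gcongr
    linarith [sq_nonneg k]
  calc _ ≤ (1 + (γ ^ 2 + k ^ 2) ^ m) * ((γ ^ 2 + k ^ 2)⁻¹) ^ (m + 1) := by gcongr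
    _ = (((γ ^ 2 + k ^ 2) ^ m)⁻¹ + 1) * (γ ^ 2 + k ^ 2)⁻¹ := by
      rw [inv_pow, pow_succ (γ ^ 2 + k ^ 2) m, mul_inv]
      field_simp
    _ ≤ _ := by gcongr

theorem integrable_pow_mul_lineDensity_pow {γ : ℝ} (hγ : 0 < γ) {j m : ℕ} (hj : j ≤ 2 * m) :
    Integrable fun k : ℝ => (-Complex.I * k) ^ j * lineDensity γ k ^ (m + 1) := by
  refine ((integrable_inv_sq_add_sq hγ).const_mul (((γ ^ 2) ^ m)⁻¹ + 1)).mono'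
    (Continuous.aestronglyMeasurable (Continuous.mul (by fun_prop)
      ((continuous_lineDensity hγ).pow _))) (Filter.Eventually.of_forall fun k => ?_)
  refine le_trans (le_of_eq ?_) (abs_pow_mul_inv_le hγ hj k)
  rw [lineDensity_eq_ofReal, norm_mul, norm_pow, norm_mul, norm_neg, Complex.norm_I, one_mul,
    norm_pow,
    Complex.norm_of_nonneg (show 0 ≤ (γ ^ 2 + k ^ 2)⁻¹ by positivity), Complex.norm_real, Real.norm_eq_abs]

theorem hermGaussian_eq_ofReal {n : ℕ} (b : ℝ) (v : Fin n × Fin n → ℝ) :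
    hermGaussian b v = (Real.exp (-b * ∑ p, v p ^ 2) : ℝ) := by
  rw [hermGaussian]
  push_cast
  rfl

theorem tendsto_hermGaussian {n : ℕ} (v : Fin n × Fin n → ℝ) :
    Filter.Tendsto (fun N : ℕ => hermGaussian (1 / ((N : ℝ) + 1)) v) Filter.atTop (nhds 1) := by
  have hc : Continuous fun b : ℝ => hermGaussian b v := by
    unfold hermGaussian
    fun_prop
  have := (hc.tendsto 0).comp tendsto_one_div_add_atTop_nhds_zero_nat
  simpa [hermGaussian, Function.comp_def] using this

theorem norm_hermGaussian_le {n : ℕ} {b : ℝ} (hb : 0 < b) (v : Fin n × Fin n → ℝ) :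
    ‖hermGaussian b v‖ ≤ 1 := by
  rw [hermGaussian_eq_ofReal, Complex.norm_of_nonneg (Real.exp_pos _).le, Real.exp_le_one_iff]
  have : 0 ≤ ∑ p, v p ^ 2 := Finset.sum_nonneg fun p _ => sq_nonneg _
  nlinarith

theorem continuous_hermGaussian {n : ℕ} (b : ℝ) :
    Continuous (hermGaussian b : (Fin n × Fin n → ℝ) → ℂ) := by
  unfold hermGaussian
  fun_prop

theorem continuous_hermDensity {n : ℕ} {γ : ℝ} (hγ : 0 < γ) :
    Continuous (hermDensity γ : (Fin n × Fin n → ℝ) → ℂ) := by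
  unfold hermDensity
  refine Continuous.inv₀ (Continuous.matrix_det
    (continuous_const.add (continuous_hermCoord.pow 2))) fun v => ?_
  rw [← det_smul_one_sub_mul_det_smul_one_add]
  exact mul_ne_zero
    (norm_pos_iff.1 ((pow_pos hγ n).trans_le ((isHermitian_hermCoord v).pow_le_norm_det hγ)))
    (norm_pos_iff.1 ((pow_pos hγ n).trans_le ((isHermitian_hermCoord v).neg.pow_le_norm_det hγ)))

theorem integrable_hermDensity_pow (m : ℕ) {γ : ℝ} (hγ : 0 < γ) :
    Integrable fun v : Fin (m + 1) × Fin (m + 1) → ℝ => hermDensity γ v ^ (m + 1) := by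
  have hg := (integrable_inv_sq_add_sq hγ).const_mul (((γ ^ 2) ^ m)⁻¹ + 1)
  obtain ⟨C, hC⟩ : ∃ C : ℝ, ∀ b : ℝ, 0 < b →
      ∫ v : Fin (m + 1) × Fin (m + 1) → ℝ, ‖hermGaussian b v * hermDensity γ v ^ (m + 1)‖ ≤ C := by
    refine ⟨‖∏ i : Fin (m + 1), (-(2 * Real.pi : ℂ)) ^ (i : ℕ)‖ * ((m + 1).factorial *
      (∫ k : ℝ, (((γ ^ 2) ^ m)⁻¹ + 1) * (γ ^ 2 + k ^ 2)⁻¹) ^ (m + 1)) /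
        (vandermonde fun j : Fin (m + 1) => ((j : ℕ) : ℝ)).det, fun b hb => ?_⟩
    obtain ⟨h1, h2, h3⟩ := (hasDetForm_gaussian (n := m + 1) hb).mul_density_pow
      (integrable_hermGaussian hb) (fun i => integrable_lineGaussian hb i) hγ (m + 1)
    refine le_trans (le_of_eq ?_) (h1.norm_zero_le (continuous_hermFourier h2) h3 hg ?_)
    · have h4 : ∀ v : Fin (m + 1) × Fin (m + 1) → ℝ,
          hermGaussian b v * hermDensity γ v ^ (m + 1) =
            (‖hermGaussian b v * hermDensity γ v ^ (m + 1)‖ : ℝ) := by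
        intro v
        obtain ⟨r, hr, hv⟩ := exists_nonneg_hermDensity_eq γ v
        rw [hv, hermGaussian_eq_ofReal, ← Complex.ofReal_pow, ← Complex.ofReal_mul,
          Complex.norm_of_nonneg (by positivity)]
      have h5 : hermFourier (fun v : Fin (m + 1) × Fin (m + 1) → ℝ =>
          hermGaussian b v * hermDensity γ v ^ (m + 1)) 0 =
          ((∫ v : Fin (m + 1) × Fin (m + 1) → ℝ,
            ‖hermGaussian b v * hermDensity γ v ^ (m + 1)‖ : ℝ) : ℂ) := by
        rw [hermFourier, ← integral_complex_ofReal]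
        refine integral_congr_ae (Filter.Eventually.of_forall fun v => ?_)
        simp only [← h4]
        simp
      rw [h5, Complex.norm_of_nonneg (integral_nonneg fun v => norm_nonneg _)]
    · intro i j hj k
      refine le_trans ?_ (abs_pow_mul_inv_le hγ (j := j + i) (m := m) (by omega) k)
      rw [lineDensity_eq_ofReal, lineGaussian, norm_mul, norm_mul, norm_pow, norm_pow, norm_mul,
        norm_neg, Complex.norm_I, one_mul, Complex.norm_real, Real.norm_eq_abs,
        Complex.norm_of_nonneg (show 0 ≤ (γ ^ 2 + k ^ 2)⁻¹ by positivity), pow_add |k| j i]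
      have key : ∀ p q e r : ℝ, 0 ≤ p → 0 ≤ q → 0 ≤ r → e ≤ 1 → p * (q * e * r) ≤ p * q * r := by
        intro p q e r hp hq hr he
        calc p * (q * e * r) = p * q * r * e := by ring
          _ ≤ p * q * r := mul_le_of_le_one_right (by positivity) he
      refine key _ _ _ _ (pow_nonneg (abs_nonneg k) _) (pow_nonneg (abs_nonneg k) _)
        (pow_nonneg (inv_nonneg.2 (by positivity)) _) ?_
      rw [Complex.norm_exp]
      have : (-(b : ℂ) * (k : ℂ) ^ 2).re = -(b * k ^ 2) := by
        rw [← Complex.ofReal_pow, ← Complex.ofReal_neg, ← Complex.ofReal_mul, Complex.ofReal_re]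
        ring
      rw [this, Real.exp_le_one_iff]
      have := sq_nonneg k
      nlinarith
  have hcont : ∀ b : ℝ, Continuous fun v : Fin (m + 1) × Fin (m + 1) → ℝ =>
      hermGaussian b v * hermDensity γ v ^ (m + 1) := fun b =>
    (continuous_hermGaussian b).mul ((continuous_hermDensity hγ).pow _)
  refine ⟨((continuous_hermDensity hγ).pow _).aestronglyMeasurable, ?_⟩
  have hlim : ∀ v : Fin (m + 1) × Fin (m + 1) → ℝ, Filter.liminf (fun N : ℕ =>
      ‖hermGaussian (1 / ((N : ℝ) + 1)) v * hermDensity γ v ^ (m + 1)‖ₑ) Filter.atTop =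
      ‖hermDensity γ v ^ (m + 1)‖ₑ := by
    intro v
    have h1 := ((tendsto_hermGaussian v).mul_const (hermDensity γ v ^ (m + 1))).enorm
    rw [one_mul] at h1
    exact h1.liminf_eq
  refine lt_of_le_of_lt ?_ (ENNReal.ofReal_lt_top (r := C))
  rw [lintegral_congr fun v => (hlim v).symm]
  refine (lintegral_liminf_le fun N => (hcont _).measurable.enorm).trans ?_
  refine Filter.liminf_le_of_le (by isBoundedDefault) fun x hx => ?_
  obtain ⟨N, hN⟩ := hx.exists
  refine hN.trans ?_
  have hb : 0 < 1 / ((N : ℝ) + 1) := by positivity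
  rw [← ofReal_integral_norm_eq_lintegral_enorm
    ((hasDetForm_gaussian (n := m + 1) hb).mul_density_pow (integrable_hermGaussian hb)
      (fun i => integrable_lineGaussian hb i) hγ (m + 1)).2.1]
  exact ENNReal.ofReal_le_ofReal (hC _ hb)

theorem hasDetForm_hermDensity_pow (m : ℕ) {γ : ℝ} (hγ : 0 < γ) :
    HasDetForm (n := m + 1) (hermFourier fun v => hermDensity γ v ^ (m + 1))
      (fun i => lineFourier fun k => (-Complex.I * k) ^ (i : ℕ) * lineDensity γ k ^ (m + 1))
      (∏ i : Fin (m + 1), (-(2 * Real.pi : ℂ)) ^ (i : ℕ)) := by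
  intro X hX x hx hchar
  have hb : ∀ N : ℕ, 0 < 1 / ((N : ℝ) + 1) := fun N => by positivity
  have h1 := fun N : ℕ => (hasDetForm_gaussian (n := m + 1) (hb N)).mul_density_pow
    (integrable_hermGaussian (hb N)) (fun i => integrable_lineGaussian (hb N) i) hγ (m + 1)
  have h2 : Filter.Tendsto (fun N : ℕ => hermFourier (fun v : Fin (m + 1) × Fin (m + 1) → ℝ =>
      hermGaussian (1 / ((N : ℝ) + 1)) v * hermDensity γ v ^ (m + 1)) X) Filter.atTop
      (nhds (hermFourier (fun v => hermDensity γ v ^ (m + 1)) X)) := by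
    refine tendsto_integral_of_dominated_convergence (fun v => ‖hermDensity γ v ^ (m + 1)‖)
      (fun N => ?_) (integrable_hermDensity_pow m hγ).norm
      (fun N => Filter.Eventually.of_forall fun v => ?_) (Filter.Eventually.of_forall fun v => ?_)
    · exact (Continuous.aestronglyMeasurable (Complex.continuous_exp.comp
        (continuous_const.mul (Complex.continuous_ofReal.comp
          (continuous_re_trace_hermCoord_mul.comp
            (continuous_id.prodMk continuous_const)))))).mul (h1 N).2.1.1
    · rw [norm_mul, norm_exp_neg_I_mul, one_mul, norm_mul]
      exact mul_le_of_le_one_left (norm_nonneg _) (norm_hermGaussian_le (hb N) v)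
    · have := (tendsto_hermGaussian v).mul_const (hermDensity γ v ^ (m + 1))
      rw [one_mul] at this
      exact this.const_mul _
  have h3 : ∀ (i : Fin (m + 1)) (t : ℝ), Filter.Tendsto (fun N : ℕ => lineFourier (fun k =>
      lineGaussian (1 / ((N : ℝ) + 1)) i k * lineDensity γ k ^ (m + 1)) t) Filter.atTop
      (nhds (lineFourier (fun k => (-Complex.I * k) ^ (i : ℕ) * lineDensity γ k ^ (m + 1)) t)) := by
    intro i t
    refine tendsto_integral_of_dominated_convergence
      (fun k : ℝ => ‖(-Complex.I * k) ^ (i : ℕ) * lineDensity γ k ^ (m + 1)‖)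
      (fun N => ?_) (integrable_pow_mul_lineDensity_pow hγ (by omega)).norm
      (fun N => Filter.Eventually.of_forall fun k => ?_) (Filter.Eventually.of_forall fun k => ?_)
    · exact (Continuous.aestronglyMeasurable (by fun_prop)).mul ((h1 N).2.2 i).1
    · rw [norm_mul, norm_exp_neg_I_mul, one_mul, norm_mul, norm_mul, lineGaussian, norm_mul]
      refine mul_le_mul_of_nonneg_right (mul_le_of_le_one_right (norm_nonneg _) ?_) (norm_nonneg _)
      rw [← Complex.ofReal_pow, ← Complex.ofReal_neg, ← Complex.ofReal_mul, ← Complex.ofReal_exp,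
        Complex.norm_of_nonneg (Real.exp_pos _).le, Real.exp_le_one_iff]
      have := mul_nonneg (hb N).le (sq_nonneg k)
      linarith
    · have hc : Continuous fun b : ℝ => lineGaussian b i k := by
        unfold lineGaussian
        fun_prop
      have := ((hc.tendsto 0).comp tendsto_one_div_add_atTop_nhds_zero_nat).mul_const
        (lineDensity γ k ^ (m + 1))
      simp only [lineGaussian, Complex.ofReal_zero, neg_zero, zero_mul, Complex.exp_zero,
        mul_one] at this
      exact this.const_mul _
  have h4 : Filter.Tendsto (fun N : ℕ => (of fun i j : Fin (m + 1) => lineFourier (fun k =>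
      lineGaussian (1 / ((N : ℝ) + 1)) i k * lineDensity γ k ^ (m + 1)) (x j)).det) Filter.atTop
      (nhds (of fun i j : Fin (m + 1) => lineFourier (fun k =>
        (-Complex.I * k) ^ (i : ℕ) * lineDensity γ k ^ (m + 1)) (x j)).det) := by
    refine ((continuous_id.matrix_det).tendsto _).comp ?_
    exact tendsto_pi_nhds.2 fun i => tendsto_pi_nhds.2 fun j => h3 i (x j)
  exact tendsto_nhds_unique_of_eventuallyEq (h2.mul_const _) (h4.const_mul _)
    (Filter.Eventually.of_forall fun N => (h1 N).1 X hX x hx hchar)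

open Real FourierTransform in
theorem fourier_exp_neg_mul_abs {γ : ℝ} (hγ : 0 < γ) :
    Integrable (fun t : ℝ => Complex.exp (-γ * |t| : ℝ)) ∧
      𝓕 (fun t : ℝ => Complex.exp (-γ * |t| : ℝ)) =
        fun ξ : ℝ => 2 * γ * lineDensity γ (2 * π * ξ) := by
  have key : ∀ s : ℝ, IntegrableOn (fun t : ℝ =>
        Complex.exp (-Complex.I * s * t) * Complex.exp (-γ * |t| : ℝ)) (Set.Iic 0) ∧
      IntegrableOn (fun t : ℝ =>
        Complex.exp (-Complex.I * s * t) * Complex.exp (-γ * |t| : ℝ)) (Set.Ioi 0) ∧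
      ∫ t : ℝ in Set.Iic 0, Complex.exp (-Complex.I * s * t) * Complex.exp (-γ * |t| : ℝ) =
        ((γ : ℂ) - Complex.I * s)⁻¹ ∧
      ∫ t : ℝ in Set.Ioi 0, Complex.exp (-Complex.I * s * t) * Complex.exp (-γ * |t| : ℝ) =
        ((γ : ℂ) + Complex.I * s)⁻¹ := by
    intro s
    have e1 : Set.EqOn (fun t : ℝ =>
        Complex.exp (-Complex.I * s * t) * Complex.exp (-γ * |t| : ℝ))
        (fun t : ℝ => Complex.exp (((γ : ℂ) - Complex.I * s) * t)) (Set.Iic 0) := by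
      intro t ht
      simp only
      rw [← Complex.exp_add, abs_of_nonpos ht]
      congr 1
      push_cast
      ring
    have e2 : Set.EqOn (fun t : ℝ =>
        Complex.exp (-Complex.I * s * t) * Complex.exp (-γ * |t| : ℝ))
        (fun t : ℝ => Complex.exp ((-((γ : ℂ) + Complex.I * s)) * t)) (Set.Ioi 0) := by
      intro t ht
      simp only
      rw [← Complex.exp_add, abs_of_pos ht]
      congr 1
      push_cast
      ring
    have r1 : 0 < ((γ : ℂ) - Complex.I * s).re := by simpa using hγ
    have r2 : (-((γ : ℂ) + Complex.I * s)).re < 0 := by simpa using hγ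
    refine ⟨(integrableOn_exp_mul_complex_Iic r1 0).congr_fun e1.symm measurableSet_Iic,
      (integrableOn_exp_mul_complex_Ioi r2 0).congr_fun e2.symm measurableSet_Ioi, ?_, ?_⟩
    · rw [setIntegral_congr_fun measurableSet_Iic e1, integral_exp_mul_complex_Iic r1]
      simp
    · rw [setIntegral_congr_fun measurableSet_Ioi e2, integral_exp_mul_complex_Ioi r2]
      rw [Complex.ofReal_zero, mul_zero, Complex.exp_zero, neg_div_neg_eq, one_div]
  have hint : ∀ s : ℝ, Integrable (fun t : ℝ =>
      Complex.exp (-Complex.I * s * t) * Complex.exp (-γ * |t| : ℝ)) := fun s => by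
    rw [← integrableOn_univ, ← Set.Iic_union_Ioi (a := (0 : ℝ))]
    exact (key s).1.union (key s).2.1
  refine ⟨by simpa using hint 0, ?_⟩
  funext ξ
  obtain ⟨-, -, k3, k4⟩ := key (2 * π * ξ)
  have h1 : 𝓕 (fun t : ℝ => Complex.exp (-γ * |t| : ℝ)) ξ = ∫ t : ℝ,
      Complex.exp (-Complex.I * (2 * π * ξ : ℝ) * t) * Complex.exp (-γ * |t| : ℝ) := by
    rw [fourier_real_eq_integral_exp_smul]
    refine integral_congr_ae (Filter.Eventually.of_forall fun t => ?_)
    simp only [smul_eq_mul]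
    congr 2
    push_cast
    ring
  rw [h1, ← integral_add_compl measurableSet_Iic (hint _), Set.compl_Iic, k3, k4, lineDensity]
  generalize 2 * π * ξ = s
  have n1 : (γ : ℂ) - Complex.I * s ≠ 0 := norm_pos_iff.1 (hγ.trans_le (norm_sub_I_mul_ge s))
  have n2 : (γ : ℂ) + Complex.I * s ≠ 0 := by
    have := norm_pos_iff.1 (hγ.trans_le (norm_sub_I_mul_ge (γ := γ) (-s)))
    simpa using this
  have n3 : (γ : ℂ) ^ 2 + (s : ℂ) ^ 2 = ((γ : ℂ) - Complex.I * s) * ((γ : ℂ) + Complex.I * s) := by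
    linear_combination (s : ℂ) ^ 2 * Complex.I_sq
  rw [n3, inv_add_inv n1 n2, div_eq_mul_inv]
  congr 1
  ring

theorem lineDensity_neg (γ k : ℝ) : lineDensity γ (-k) = lineDensity γ k := by
  simp [lineDensity]

theorem lineFourier_lineDensity_pow_neg (γ : ℝ) (m : ℕ) (x : ℝ) :
    lineFourier (fun k => lineDensity γ k ^ m) (-x) = lineFourier (fun k => lineDensity γ k ^ m) x := by
  rw [lineFourier_neg]
  simp only [lineDensity_neg]

open Real FourierTransform in
theorem lineFourier_lineDensity {γ : ℝ} (hγ : 0 < γ) (x : ℝ) :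
    lineFourier (lineDensity γ) x = (π / γ * rexp (-γ * |x|) : ℝ) := by
  obtain ⟨h1, h2⟩ := fourier_exp_neg_mul_abs hγ
  have h3 : Integrable (lineDensity γ) := by
    simpa using integrable_pow_mul_lineDensity_pow hγ (j := 0) (m := 0) le_rfl
  have h4 : 𝓕⁻ (𝓕 fun t : ℝ => Complex.exp (-γ * |t| : ℝ)) =
      fun t : ℝ => Complex.exp (-γ * |t| : ℝ) := Continuous.fourierInv_fourier_eq
    (Complex.continuous_exp.comp (Complex.continuous_ofReal.comp (by fun_prop))) h1
    (h2 ▸ (h3.comp_mul_left' (mul_ne_zero two_ne_zero pi_ne_zero)).const_mul _)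
  have h5 := congrFun h4 (-x)
  rw [h2, fourierInv_eq'] at h5
  have h6 : ∀ ξ : ℝ, Complex.exp ((2 * π * inner ℝ ξ (-x) : ℝ) * Complex.I) •
      (2 * γ * lineDensity γ (2 * π * ξ)) = 2 * γ *
        (fun k : ℝ => Complex.exp (-Complex.I * (k * x : ℝ)) * lineDensity γ k) (2 * π * ξ) := by
    intro ξ
    simp only [smul_eq_mul]
    rw [mul_left_comm]
    congr 3
    simp only [RCLike.inner_apply, conj_trivial]
    push_cast
    ring
  rw [integral_congr_ae (Filter.Eventually.of_forall h6), integral_const_mul,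
    Measure.integral_comp_mul_left
      (fun k : ℝ => Complex.exp (-Complex.I * (k * x : ℝ)) * lineDensity γ k) (2 * π),
    abs_neg, ← lineFourier, abs_of_pos (by positivity),
    Complex.real_smul, ← Complex.ofReal_exp] at h5
  have hγ' : (γ : ℂ) ≠ 0 := Complex.ofReal_ne_zero.2 hγ.ne'
  have hπ : (π : ℂ) ≠ 0 := Complex.ofReal_ne_zero.2 pi_ne_zero
  rw [Complex.ofReal_mul, ← h5]
  push_cast
  field_simp

theorem hasDerivAt_lineDensity {γ : ℝ} (hγ : 0 < γ) (m : ℕ) (k : ℝ) :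
    HasDerivAt (fun k : ℝ => lineDensity γ k ^ m)
      (-(2 * m * k) * lineDensity γ k ^ (m + 1)) k := by
  have h0 : (γ : ℂ) ^ 2 + (k : ℂ) ^ 2 ≠ 0 := by
    have : γ ^ 2 + k ^ 2 ≠ 0 := by positivity
    exact_mod_cast this
  have h1 : HasDerivAt (fun y : ℂ => (((γ : ℂ) ^ 2 + y ^ 2)⁻¹) ^ m) _ (k : ℂ) :=
    (((hasDerivAt_pow 2 (k : ℂ)).const_add ((γ : ℂ) ^ 2)).fun_inv h0).fun_pow m
  refine h1.comp_ofReal.congr_deriv ?_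
  rw [lineDensity]
  rcases m with _ | m
  · simp
  · simp only [Nat.add_sub_cancel]
    rw [pow_succ _ (m + 1), pow_succ _ m]
    push_cast
    field_simp

theorem lineFourier_neg_I_mul_lineDensity_pow {γ : ℝ} (hγ : 0 < γ) (m : ℕ) (x : ℝ) :
    lineFourier (fun k => -Complex.I * k * lineDensity γ k ^ (m + 2)) x =
      -(x / (2 * (m + 1))) * lineFourier (fun k => lineDensity γ k ^ (m + 1)) x := by
  have hint1 : Integrable fun k : ℝ => lineDensity γ k ^ (m + 1) := by
    simpa using integrable_pow_mul_lineDensity_pow hγ (j := 0) (m := m) (by omega)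
  have hint2 : Integrable fun k : ℝ => -Complex.I * k * lineDensity γ k ^ (m + 2) := by
    simpa using integrable_pow_mul_lineDensity_pow hγ (j := 1) (m := m + 1) (by omega)
  have hbdd : ∀ {w : ℝ → ℂ}, Integrable w →
      Integrable fun k : ℝ => Complex.exp (-Complex.I * (k * x : ℝ)) * w k := fun hw =>
    hw.bdd_mul (Continuous.aestronglyMeasurable (by fun_prop)) (c := 1)
      (Filter.Eventually.of_forall fun k => (norm_exp_neg_I_mul _).le)
  have hu : ∀ k : ℝ, HasDerivAt (fun k : ℝ => Complex.exp (-Complex.I * (k * x : ℝ)))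
      (Complex.exp (-Complex.I * (k * x : ℝ)) * (-Complex.I * x)) k := by
    intro k
    have h1 : HasDerivAt (fun y : ℝ => (-Complex.I * (y * x : ℝ) : ℂ)) (-Complex.I * x) k := by
      have := ((hasDerivAt_id k).mul_const x).ofReal_comp.const_mul (-Complex.I)
      simpa using this
    exact h1.cexp
  have hm : (m : ℂ) + 1 ≠ 0 := Nat.cast_add_one_ne_zero m
  have hv' : ∀ k : ℝ, -Complex.I * k * lineDensity γ k ^ (m + 2) =
      Complex.I / (2 * (m + 1)) * (-(2 * (m + 1 : ℕ) * k) * lineDensity γ k ^ (m + 1 + 1)) := by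
    intro k
    push_cast
    field_simp
  have hint3 : Integrable fun k : ℝ =>
      -(2 * (m + 1 : ℕ) * k : ℂ) * lineDensity γ k ^ (m + 1 + 1) := by
    refine (hint2.const_mul ((2 * (m + 1)) / Complex.I)).congr
      (Filter.Eventually.of_forall fun k => ?_)
    simp only [hv']
    rw [← mul_assoc, div_mul_div_cancel₀ Complex.I_ne_zero, div_self (mul_ne_zero two_ne_zero hm),
      one_mul]
  have hparts := integral_mul_deriv_eq_deriv_mul_of_integrable (fun k _ => hu k)
    (fun k _ => hasDerivAt_lineDensity hγ (m + 1) k) (hbdd hint3)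
    (((hbdd hint1).const_mul (-Complex.I * x)).congr
      (Filter.Eventually.of_forall fun k => by simp only [Pi.mul_apply]; ring)) (hbdd hint1)
  simp only [lineFourier, hv', mul_left_comm _ (Complex.I / (2 * (m + 1)))]
  rw [integral_const_mul, hparts, ← integral_neg, ← integral_const_mul, ← integral_const_mul]
  refine integral_congr_ae (Filter.Eventually.of_forall fun k => ?_)
  have hI := Complex.I_sq
  field_simp
  linear_combination (x * lineDensity γ k ^ (m + 1)) * hI

/-- The coefficient of `y^(n-l)` in the `n`-th reverse Bessel polynomial. -/
noncomputable def reverseBesselCoeff (n l : ℕ) : ℝ :=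
  ((n + l).factorial : ℝ) / ((l.factorial : ℝ) * ((n - l).factorial : ℝ) * 2 ^ l)

/-- The reverse Bessel polynomials. -/
noncomputable def reverseBessel (n : ℕ) (y : ℝ) : ℝ :=
  ∑ l ∈ Finset.range (n + 1), reverseBesselCoeff n l * y ^ (n - l)

theorem reverseBesselCoeff_zero (n : ℕ) : reverseBesselCoeff n 0 = 1 := by
  have : (n.factorial : ℝ) ≠ 0 := Nat.cast_ne_zero.2 n.factorial_ne_zero
  simp [reverseBesselCoeff, this]

theorem reverseBesselCoeff_succ_self (n : ℕ) :
    reverseBesselCoeff (n + 1) (n + 1) = reverseBesselCoeff (n + 1) n := by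
  have h1 : (n.factorial : ℝ) ≠ 0 := Nat.cast_ne_zero.2 n.factorial_ne_zero
  rw [reverseBesselCoeff, reverseBesselCoeff, Nat.sub_self, Nat.add_sub_cancel_left,
    show n + 1 + (n + 1) = (n + 1 + n) + 1 by ring, Nat.factorial_succ (n + 1 + n),
    Nat.factorial_succ n]
  push_cast
  field_simp
  simp
  ring

theorem reverseBesselCoeff_recurrence {n l : ℕ} (h : l < n) :
    reverseBesselCoeff (n + 1) l * ((n + 1 - l : ℕ) : ℝ) =
      reverseBesselCoeff (n + 1) (l + 1) - reverseBesselCoeff n (l + 1) := by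
  obtain ⟨d, rfl⟩ := Nat.exists_eq_add_of_lt h
  have h1 : (l.factorial : ℝ) ≠ 0 := Nat.cast_ne_zero.2 l.factorial_ne_zero
  have h2 : (d.factorial : ℝ) ≠ 0 := Nat.cast_ne_zero.2 d.factorial_ne_zero
  rw [reverseBesselCoeff, reverseBesselCoeff, reverseBesselCoeff,
    show l + d + 1 + 1 - l = d + 1 + 1 by omega, show l + d + 1 + 1 - (l + 1) = d + 1 by omega,
    show l + d + 1 - (l + 1) = d by omega, show l + d + 1 + 1 + l = 2 * l + d + 2 by ring,
    show l + d + 1 + 1 + (l + 1) = 2 * l + d + 2 + 1 by ring,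
    show l + d + 1 + (l + 1) = 2 * l + d + 2 by ring, Nat.factorial_succ (2 * l + d + 2),
    Nat.factorial_succ l, Nat.factorial_succ (d + 1), Nat.factorial_succ d]
  push_cast
  field_simp
  ring

theorem hasDerivAt_reverseBessel_succ (n : ℕ) (y : ℝ) :
    HasDerivAt (reverseBessel (n + 1)) (reverseBessel (n + 1) y - y * reverseBessel n y) y := by
  have h1 : HasDerivAt (reverseBessel (n + 1)) (∑ l ∈ Finset.range (n + 1 + 1),
      reverseBesselCoeff (n + 1) l * (((n + 1 - l : ℕ) : ℝ) * y ^ (n + 1 - l - 1))) y :=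
    HasDerivAt.fun_sum fun l _ => (hasDerivAt_pow (n + 1 - l) y).const_mul _
  refine h1.congr_deriv ?_
  have h2 : y * reverseBessel n y =
      y ^ (n + 1) + ∑ l ∈ Finset.range n, reverseBesselCoeff n (l + 1) * y ^ (n - l) := by
    rw [reverseBessel, Finset.sum_range_succ', mul_add, Finset.mul_sum, add_comm,
      reverseBesselCoeff_zero, one_mul, Nat.sub_zero, pow_succ' y n]
    congr 1
    refine Finset.sum_congr rfl fun l hl => ?_
    have hl' := Finset.mem_range.1 hl
    rw [show n - l = (n - (l + 1)) + 1 by omega, pow_succ]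
    ring
  have h3 : ∀ l ∈ Finset.range n,
      reverseBesselCoeff (n + 1) l * (((n + 1 - l : ℕ) : ℝ) * y ^ (n + 1 - l - 1)) =
        reverseBesselCoeff (n + 1) (l + 1) * y ^ (n + 1 - (l + 1)) -
          reverseBesselCoeff n (l + 1) * y ^ (n - l) := by
    intro l hl
    have hl' := Finset.mem_range.1 hl
    rw [← mul_assoc, reverseBesselCoeff_recurrence hl', show n + 1 - l - 1 = n - l by omega,
      show n + 1 - (l + 1) = n - l by omega]
    ring
  have h4 : reverseBessel (n + 1) y =
      ∑ l ∈ Finset.range n, reverseBesselCoeff (n + 1) (l + 1) * y ^ (n + 1 - (l + 1)) +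
        reverseBesselCoeff (n + 1) n + y ^ (n + 1) := by
    rw [reverseBessel, Finset.sum_range_succ', Finset.sum_range_succ, reverseBesselCoeff_zero,
      reverseBesselCoeff_succ_self]
    simp
  rw [h2, h4, Finset.sum_range_succ, Finset.sum_range_succ, Finset.sum_congr rfl h3,
    Finset.sum_sub_distrib, Nat.sub_self, Nat.add_sub_cancel_left]
  simp
  ring

/-- `fM γ (m + 1)` on the positive half line. -/
noncomputable def besselDecay (γ : ℝ) (m : ℕ) (x : ℝ) : ℝ :=
  Real.pi / (γ ^ (2 * m + 1) * 2 ^ m * m.factorial) * Real.exp (-γ * x) * reverseBessel m (γ * x)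

theorem fM_succ_eq_besselDecay {γ : ℝ} (hγ : 0 < γ) (m : ℕ) (x : ℝ) :
    fM γ (m + 1) x = besselDecay γ m |x| := by
  rw [fM, besselDecay, abs_mul, abs_of_pos hγ]
  rfl

theorem hasDerivAt_besselDecay_succ {γ : ℝ} (hγ : 0 < γ) (m : ℕ) (x : ℝ) :
    HasDerivAt (besselDecay γ (m + 1)) (-(x / (2 * (m + 1))) * besselDecay γ m x) x := by
  have h1 : HasDerivAt (fun y : ℝ => Real.exp (-γ * y)) (Real.exp (-γ * x) * -γ) x := by
    simpa using ((hasDerivAt_id x).const_mul (-γ)).exp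
  have h2 : HasDerivAt (fun y : ℝ => reverseBessel (m + 1) (γ * y)) _ x :=
    (hasDerivAt_reverseBessel_succ m (γ * x)).comp x (by simpa using (hasDerivAt_id x).const_mul γ)
  have h3 : HasDerivAt (besselDecay γ (m + 1)) _ x := (h1.const_mul
    (Real.pi / (γ ^ (2 * (m + 1) + 1) * 2 ^ (m + 1) * (m + 1).factorial))).mul h2
  refine h3.congr_deriv ?_
  rw [besselDecay, Nat.factorial_succ]
  have h4 : (m.factorial : ℝ) ≠ 0 := Nat.cast_ne_zero.2 m.factorial_ne_zero
  have h5 : (m : ℝ) + 1 ≠ 0 := by positivity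
  push_cast
  rw [show 2 * (m + 1) + 1 = 2 * m + 1 + 2 by ring, pow_add γ (2 * m + 1) 2, pow_succ 2 m]
  field_simp
  ring

theorem tendsto_besselDecay {γ : ℝ} (hγ : 0 < γ) (m : ℕ) :
    Filter.Tendsto (besselDecay γ m) Filter.atTop (nhds 0) := by
  have h1 : Filter.Tendsto (fun y : ℝ => Real.pi / (γ ^ (2 * m + 1) * 2 ^ m * m.factorial) *
      ∑ l ∈ Finset.range (m + 1), reverseBesselCoeff m l * (y ^ (m - l) * Real.exp (-y)))
      Filter.atTop (nhds (Real.pi / (γ ^ (2 * m + 1) * 2 ^ m * m.factorial) *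
        ∑ l ∈ Finset.range (m + 1), reverseBesselCoeff m l * 0)) :=
    (tendsto_finsetSum _ fun l _ =>
      (Real.tendsto_pow_mul_exp_neg_atTop_nhds_zero (m - l)).const_mul _).const_mul _
  simp only [mul_zero, Finset.sum_const_zero] at h1
  refine (h1.comp (Filter.tendsto_id.const_mul_atTop hγ)).congr fun x => ?_
  simp only [Function.comp_apply, id, besselDecay, reverseBessel]
  rw [Finset.mul_sum, Finset.mul_sum, neg_mul]
  exact Finset.sum_congr rfl fun l _ => by ring

theorem integrable_lineDensity_pow_succ {γ : ℝ} (hγ : 0 < γ) (m : ℕ) :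
    Integrable fun k : ℝ => lineDensity γ k ^ (m + 1) := by
  simpa using integrable_pow_mul_lineDensity_pow hγ (j := 0) (m := m) (by omega)

theorem tendsto_lineFourier_lineDensity_pow {γ : ℝ} (hγ : 0 < γ) (m : ℕ) :
    Filter.Tendsto (lineFourier fun k => lineDensity γ k ^ (m + 1)) Filter.atTop (nhds 0) := by
  have h1 : Filter.Tendsto (fun x : ℝ => 2 * (m + 1) *
      (∫ k : ℝ, ‖-Complex.I * k * lineDensity γ k ^ (m + 2)‖) * x⁻¹) Filter.atTop (nhds 0) := by
    simpa using tendsto_inv_atTop_zero.const_mul (2 * ((m : ℝ) + 1) *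
      (∫ k : ℝ, ‖-Complex.I * k * lineDensity γ k ^ (m + 2)‖))
  refine squeeze_zero_norm' ?_ h1
  filter_upwards [Filter.eventually_gt_atTop 0] with x hx
  have h2 := lineFourier_neg_I_mul_lineDensity_pow hγ m x
  have h3 := norm_lineFourier_le (fun k : ℝ => -Complex.I * k * lineDensity γ k ^ (m + 2)) x
  have h4 : ‖-((x : ℂ) / (2 * (m + 1)))‖ = x / (2 * (m + 1)) := by
    rw [norm_neg, show (x : ℂ) / (2 * (m + 1)) = ((x / (2 * (m + 1)) : ℝ) : ℂ) by push_cast; rfl,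
      Complex.norm_of_nonneg (by positivity)]
  rw [h2, norm_mul, h4, div_mul_eq_mul_div, div_le_iff₀ (by positivity)] at h3
  rw [← div_eq_mul_inv, le_div_iff₀ hx]
  linarith

theorem lineFourier_lineDensity_pow_of_pos {γ : ℝ} (hγ : 0 < γ) (m : ℕ) {x : ℝ} (hx : 0 < x) :
    lineFourier (fun k => lineDensity γ k ^ (m + 1)) x = besselDecay γ m x := by
  induction m generalizing x with
  | zero =>
    simp only [zero_add, pow_one]
    rw [lineFourier_lineDensity hγ, abs_of_pos hx]
    simp [besselDecay, reverseBessel, reverseBesselCoeff_zero]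
  | succ m ih =>
    let d : ℝ → ℂ := fun y =>
      lineFourier (fun k => lineDensity γ k ^ (m + 2)) y - (besselDecay γ (m + 1) y : ℂ)
    have hd : ∀ y : ℝ, 0 < y → HasDerivAt d 0 y := by
      intro y hy
      have h1 := hasDerivAt_lineFourier (integrable_lineDensity_pow_succ hγ (m + 1))
        (by simpa using integrable_pow_mul_lineDensity_pow hγ (j := 1) (m := m + 1) (by omega)) y
      refine (h1.sub (hasDerivAt_besselDecay_succ hγ m y).ofReal_comp).congr_deriv ?_
      rw [lineFourier_neg_I_mul_lineDensity_pow hγ, ih hy]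
      push_cast
      ring
    have hconst : ∀ y : ℝ, 0 < y → d y = d x := fun y hy =>
      isOpen_Ioi.is_const_of_deriv_eq_zero isPreconnected_Ioi
        (fun z hz => (hd z hz).differentiableAt.differentiableWithinAt)
        (fun z hz => (hd z hz).deriv) (Set.mem_Ioi.2 hy) (Set.mem_Ioi.2 hx)
    have hlim : Filter.Tendsto d Filter.atTop (nhds 0) := by
      have := (tendsto_lineFourier_lineDensity_pow hγ (m + 1)).sub
        ((Complex.continuous_ofReal.tendsto 0).comp (tendsto_besselDecay hγ (m + 1)))
      simpa using this
    have hd0 : d x = 0 := by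
      refine tendsto_nhds_unique (tendsto_const_nhds.congr' ?_) hlim
      filter_upwards [Filter.eventually_gt_atTop 0] with y hy using (hconst y hy).symm
    exact sub_eq_zero.1 hd0

theorem lineFourier_lineDensity_pow {γ : ℝ} (hγ : 0 < γ) (m : ℕ) {x : ℝ} (hx : x ≠ 0) :
    lineFourier (fun k => lineDensity γ k ^ (m + 1)) x = fM γ (m + 1) x := by
  rw [fM_succ_eq_besselDecay hγ, ← lineFourier_lineDensity_pow_of_pos hγ m (abs_pos.2 hx)]
  rcases abs_choice x with h | h
  · rw [h]
  · rw [h, lineFourier_lineDensity_pow_neg]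

theorem iteratedDeriv_fM {γ : ℝ} (hγ : 0 < γ) (m : ℕ) {i : ℕ} (hi : i ≤ 2 * m) {x : ℝ}
    (hx : x ≠ 0) : ((iteratedDeriv i (fM γ (m + 1)) x : ℝ) : ℂ) =
      lineFourier (fun k => (-Complex.I * k) ^ i * lineDensity γ k ^ (m + 1)) x := by
  induction i generalizing x with
  | zero => simpa using (lineFourier_lineDensity_pow hγ m hx).symm
  | succ i ih =>
    have hsucc : (fun k : ℝ => (-Complex.I * k) ^ (i + 1) * lineDensity γ k ^ (m + 1)) =
        fun k : ℝ => -Complex.I * k * ((-Complex.I * k) ^ i * lineDensity γ k ^ (m + 1)) := by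
      funext k
      ring
    have h1 := hasDerivAt_lineFourier (integrable_pow_mul_lineDensity_pow hγ (j := i) (by omega))
      (hsucc ▸ integrable_pow_mul_lineDensity_pow hγ hi) x
    rw [← hsucc] at h1
    have hev : (fun y => ((iteratedDeriv i (fM γ (m + 1)) y : ℝ) : ℂ)) =ᶠ[nhds x]
        lineFourier fun k : ℝ => (-Complex.I * k) ^ i * lineDensity γ k ^ (m + 1) := by
      filter_upwards [isOpen_ne.mem_nhds hx] with y hy using ih (by omega) hy
    have h2 := h1.congr_of_eventuallyEq hev
    have h3 : HasDerivAt (iteratedDeriv i (fM γ (m + 1))) _ x :=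
      Complex.reCLM.hasFDerivAt.comp_hasDerivAt x h2
    rw [iteratedDeriv_succ, h3.deriv]
    exact h3.ofReal_comp.unique h2

/-- The coordinates `hermCoord` as an isomorphism onto the Hermitian matrices. -/
noncomputable def selfAdjointCoord (n : ℕ) :
    selfAdjoint (Matrix (Fin n) (Fin n) ℂ) ≃+ (Fin n × Fin n → ℝ) where
  toFun K p := (K.1 p.1 p.2).re + (K.1 p.1 p.2).im
  invFun v := ⟨hermCoord v, isHermitian_hermCoord v⟩
  left_inv K := by
    refine Subtype.ext (Matrix.ext fun i j => ?_)
    have h : K.1 j i = star (K.1 i j) := (IsHermitian.apply (A := K.1) K.2 j i).symm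
    refine Complex.ext ?_ ?_ <;> simp [hermCoord, h] <;> ring
  right_inv v := by
    funext p
    simp [hermCoord]
    ring
  map_add' K K' := by
    funext p
    simp
    ring

theorem exists_integral_selfAdjoint_eq {n : ℕ} (μ : Measure (selfAdjoint (Matrix (Fin n) (Fin n) ℂ)))
    [μ.IsAddHaarMeasure] : ∃ c : ℂ, c ≠ 0 ∧ ∀ F : Matrix (Fin n) (Fin n) ℂ → ℂ,
      ∫ K : selfAdjoint (Matrix (Fin n) (Fin n) ℂ), F K ∂μ =
        c * ∫ v : Fin n × Fin n → ℝ, F (hermCoord v) := by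
  have : BorelSpace (Matrix (Fin n) (Fin n) ℂ) := inferInstanceAs (BorelSpace (Fin n → Fin n → ℂ))
  have hcont : Continuous (selfAdjointCoord n) := by
    refine continuous_pi fun p => ?_
    have h : Continuous fun K : selfAdjoint (Matrix (Fin n) (Fin n) ℂ) => K.1 p.1 p.2 :=
      continuous_subtype_val.matrix_elem _ _
    exact (Complex.continuous_re.comp h).add (Complex.continuous_im.comp h)
  have hcont' : Continuous (selfAdjointCoord n).symm := continuous_hermCoord.subtype_mk _
  have hHaar : (μ.map (selfAdjointCoord n)).IsAddHaarMeasure :=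
    (selfAdjointCoord n).isAddHaarMeasure_map μ hcont hcont'
  obtain ⟨c, hc, hsmul⟩ : ∃ c : NNReal, c ≠ 0 ∧ μ.map (selfAdjointCoord n) = c • volume :=
    ⟨_, (Measure.addHaarScalarFactor_pos_of_isAddHaarMeasure _ volume).ne',
      Measure.isAddLeftInvariant_eq_smul _ volume⟩
  refine ⟨((c : ℝ) : ℂ), Complex.ofReal_ne_zero.2 (NNReal.coe_ne_zero.2 hc), fun F => ?_⟩
  let e : selfAdjoint (Matrix (Fin n) (Fin n) ℂ) ≃ₜ (Fin n × Fin n → ℝ) :=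
    ⟨(selfAdjointCoord n).toEquiv, hcont, hcont'⟩
  have h1 := e.measurableEmbedding.integral_map (μ := μ) fun v => F (hermCoord v)
  have h2 : ∀ K, hermCoord (e K) = (K : Matrix (Fin n) (Fin n) ℂ) := fun K =>
    congrArg Subtype.val ((selfAdjointCoord n).symm_apply_apply K)
  simp only [h2] at h1
  rw [← h1, show ((e : selfAdjoint (Matrix (Fin n) (Fin n) ℂ) → _)) = selfAdjointCoord n from rfl,
    hsmul, integral_smul_nnreal_measure, NNReal.smul_def, Complex.real_smul]

theorem integral_exp_trace_mul_inv_det_pow {n : ℕ} (γ a : ℝ) (m : ℕ)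
    {X : Matrix (Fin n) (Fin n) ℂ} (hX : X.IsHermitian) :
    ∫ v : Fin n × Fin n → ℝ, Complex.exp (-Complex.I * (hermCoord v * X).trace) *
      (((γ : ℂ) ^ 2 • (1 : Matrix (Fin n) (Fin n) ℂ) +
        (hermCoord v - (a : ℂ) • 1) ^ 2).det ^ m)⁻¹ =
      Complex.exp (-Complex.I * a * X.trace) * hermFourier (fun v => hermDensity γ v ^ m) X := by
  let v₀ : Fin n × Fin n → ℝ := fun p => if p.1 = p.2 then a else 0
  have hadd : ∀ v, hermCoord (v + v₀) = hermCoord v + (a : ℂ) • 1 := by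
    intro v
    ext i j
    rcases eq_or_ne i j with h | h
    · subst h
      simp [hermCoord, v₀]
      ring
    · simp [hermCoord, v₀, h, h.symm]
  rw [← integral_add_right_eq_self _ v₀, hermFourier, ← integral_const_mul]
  refine integral_congr_ae (Filter.Eventually.of_forall fun v => ?_)
  simp only
  rw [hadd, add_sub_cancel_right, add_mul, trace_add, Matrix.smul_mul, Matrix.one_mul, trace_smul,
    smul_eq_mul, mul_add, Complex.exp_add, (isHermitian_hermCoord v).re_trace_mul hX, hermDensity,
    inv_pow, ← mul_assoc (-Complex.I) (a : ℂ)]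
  ring

/-- Fix `M ≥ 1`, `γ > 0` and choose an additive Haar (Lebesgue) measure `μ`
on the `M×M` Hermitian complex matrices.  There is a nonzero constant `C`, depending only
on `M`, `γ` and the normalization `μ` (not on `X` nor on `α`), such that for every real `α`
and every Hermitian `X` with pairwise distinct nonzero eigenvalues `x_1, …, x_M`:
`∫ e^{-i Tr(KX)} det[γ²1 + (K-γα1)²]^{-M} dK
   = C · e^{-iγα Tr X} · det[f_M^{(i-1)}(x_j)] / ∏_{i<j}(x_i - x_j)`. -/
theorem cauchy_char_function_det_form (M : ℕ) (hM : 1 ≤ M) (γ : ℝ) (hγ : 0 < γ)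
    (μ : Measure (selfAdjoint (Matrix (Fin M) (Fin M) ℂ))) (hμ : μ.IsAddHaarMeasure) :
    ∃ C : ℂ, C ≠ 0 ∧ ∀ α : ℝ, ∀ X : Matrix (Fin M) (Fin M) ℂ, ∀ hX : X.IsHermitian,
      Function.Injective hX.eigenvalues → (∀ c, hX.eigenvalues c ≠ 0) →
      (∫ K : selfAdjoint (Matrix (Fin M) (Fin M) ℂ),
          Complex.exp (-Complex.I * Matrix.trace ((K : Matrix (Fin M) (Fin M) ℂ) * X)) *
            (Matrix.det (((γ : ℂ) ^ 2) • (1 : Matrix (Fin M) (Fin M) ℂ) +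
              ((K : Matrix (Fin M) (Fin M) ℂ) - ((γ : ℂ) * (α : ℂ)) • 1) ^ 2) ^ M)⁻¹ ∂μ)
        = C * Complex.exp (-Complex.I * (γ : ℂ) * (α : ℂ) * Matrix.trace X) *
            (Matrix.det (Matrix.of fun i j : Fin M =>
              ((iteratedDeriv (i : ℕ) (fM γ M) (hX.eigenvalues j) : ℝ) : ℂ)) /
              ∏ i : Fin M, ∏ j ∈ Finset.Ioi i,
                ((hX.eigenvalues i : ℂ) - (hX.eigenvalues j : ℂ))) := by
  have : μ.IsAddHaarMeasure := hμ
  obtain ⟨m, rfl⟩ : ∃ m, M = m + 1 := ⟨M - 1, (Nat.sub_add_cancel hM).symm⟩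
  obtain ⟨c, hc, hint⟩ := exists_integral_selfAdjoint_eq μ
  have hpi : (-(2 * Real.pi : ℂ)) ≠ 0 :=
    neg_ne_zero.2 (mul_ne_zero two_ne_zero (Complex.ofReal_ne_zero.2 Real.pi_ne_zero))
  have hs := vandermondeSign_mul_self (m + 1)
  have hs0 : vandermondeSign (m + 1) ≠ 0 := fun h => by simp [h] at hs
  refine ⟨c * (∏ i : Fin (m + 1), (-(2 * Real.pi : ℂ)) ^ (i : ℕ)) * vandermondeSign (m + 1),
    mul_ne_zero (mul_ne_zero hc (Finset.prod_ne_zero_iff.2 fun i _ => pow_ne_zero _ hpi)) hs0,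
    fun α X hX hinj hne => ?_⟩
  have hform := hasDetForm_hermDensity_pow m hγ X hX hX.eigenvalues hinj hX.charpoly_eq
  have hV : ((vandermonde hX.eigenvalues).det : ℂ) ≠ 0 :=
    Complex.ofReal_ne_zero.2 (det_vandermonde_ne_zero_iff.2 hinj)
  have hentry : (of fun i j : Fin (m + 1) =>
      ((iteratedDeriv (i : ℕ) (fM γ (m + 1)) (hX.eigenvalues j) : ℝ) : ℂ)) =
      of fun i j : Fin (m + 1) => lineFourier
        (fun k => (-Complex.I * k) ^ (i : ℕ) * lineDensity γ k ^ (m + 1)) (hX.eigenvalues j) :=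
    Matrix.ext fun i j => iteratedDeriv_fM hγ m (by omega) (hne j)
  have hshift := integral_exp_trace_mul_inv_det_pow γ (γ * α) (m + 1) hX
  push_cast at hshift
  refine (hint fun K => Complex.exp (-Complex.I * (K * X).trace) *
    (((γ : ℂ) ^ 2 • (1 : Matrix (Fin (m + 1)) (Fin (m + 1)) ℂ) +
      (K - ((γ : ℂ) * (α : ℂ)) • 1) ^ 2).det ^ (m + 1))⁻¹).trans ?_
  rw [hshift, hentry, prod_sub_eq_vandermondeSign_mul, ← mul_assoc (-Complex.I) (γ : ℂ) (α : ℂ),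
    mul_div_assoc', eq_div_iff (mul_ne_zero hs0 hV)]
  linear_combination c * Complex.exp (-Complex.I * γ * α * X.trace) * vandermondeSign (m + 1) * hform
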